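/- arXiv:1807.09889 — 3 statements merged into one kernel-verified Lean document; each statement's English description precedes it below -/
import Mathlib

section
/- Let A be a prime noetherian ring of injective dimension one. Then every finitely generated torsion right A-module M satisfies Ext^n_A(M, A) ≠ 0 if and only if n = 1, and every finitely generated torsionfree right A-module P satisfies Ext^n_A(P, A) ≠ 0 if and only if n = 0; that is, torsion modules are Cohen–Macaulay of grade 1 and torsionfree modules are maximal Cohen–Macaulay. -/
/- STATEMENT 1:
Let `A` be a prime noetherian ring of injective dimension one (on both sides). Then every
(nonzero) finitely generated torsion right `A`-module `M` satisfies `Ext^n_A(M, A) ≠ 0 ↔ n = 1`,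
and every (nonzero) finitely generated torsionfree right `A`-module `P` satisfies
`Ext^n_A(P, A) ≠ 0 ↔ n = 0`: torsion modules are Cohen–Macaulay of grade one and torsionfree
modules are maximal Cohen–Macaulay.

Right `A`-modules are modules over `Aᵐᵒᵖ`; the right regular module is `Aᵐᵒᵖ`. -/

open CategoryTheory

def IsPrimeRing (A : Type) [Ring A] : Prop :=
  ∀ a b : A, (∀ x : A, a * x * b = 0) → a = 0 ∨ b = 0

noncomputable abbrev extGrp (B : Type) [Ring B] (n : ℕ) (M N : ModuleCat B) : Type :=
  ((Ext ℤ (ModuleCat B) n).obj (Opposite.op M)).obj N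

def RightTorsionFree (A : Type) [Ring A] (M : Type) [AddCommGroup M] [Module Aᵐᵒᵖ M] : Prop :=
  ∀ m : M, m ≠ 0 → ∀ a ∈ nonZeroDivisors A, (MulOpposite.op a) • m ≠ 0

/-- A right `A`-module is torsion if every element is annihilated by a regular element. -/
def RightTorsion (A : Type) [Ring A] (M : Type) [AddCommGroup M] [Module Aᵐᵒᵖ M] : Prop :=
  ∀ m : M, ∃ a ∈ nonZeroDivisors A, (MulOpposite.op a) • m = 0

def RightSelfInjDimLE (A : Type) [Ring A] (d : ℕ) : Prop :=
  ∀ (M : ModuleCat Aᵐᵒᵖ) (n : ℕ), d < n →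
    Subsingleton (extGrp Aᵐᵒᵖ n M (ModuleCat.of Aᵐᵒᵖ Aᵐᵒᵖ))

def LeftSelfInjDimLE (A : Type) [Ring A] (d : ℕ) : Prop :=
  ∀ (M : ModuleCat A) (n : ℕ), d < n →
    Subsingleton (extGrp A n M (ModuleCat.of A A))

section Homological
variable {B : Type} [Ring B]

lemma subsingleton_extGrp_iff_exactAt {M : ModuleCat B} (P : ProjectiveResolution M)
    (N : ModuleCat B) (n : ℕ) :
    Subsingleton (extGrp B n M N) ↔ (P.complex.linearYonedaObj ℤ N).ExactAt n := by
  rw [HomologicalComplex.exactAt_iff_isZero_homology, ModuleCat.isZero_iff_subsingleton]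
  exact (((forget _).mapIso (P.isoExt (R := ℤ) n N)).toEquiv).subsingleton_congr

lemma subsingleton_extGrp_zero_iff (M N : ModuleCat B) :
    Subsingleton (extGrp B 0 M N) ↔ Subsingleton (M ⟶ N) := by
  let P := ProjectiveResolution.of M
  rw [subsingleton_extGrp_iff_exactAt P,
    HomologicalComplex.exactAt_iff' _ 0 0 1 (by simp) (by simp),
    ShortComplex.moduleCat_exact_iff]
  have hd : (P.complex.linearYonedaObj ℤ N).d 0 0 = 0 :=
    HomologicalComplex.shape _ _ _ (by simp)
  constructor
  · intro h
    refine subsingleton_of_forall_eq 0 fun f => ?_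
    have hf : P.complex.d 1 0 ≫ P.π.f 0 ≫ f = 0 :=
      (P.complex_d_comp_π_f_zero_assoc f).trans Limits.zero_comp
    obtain ⟨x, hx⟩ := h (P.π.f 0 ≫ f) hf
    have hx' : P.π.f 0 ≫ f = 0 := hx.symm.trans (by
      change (P.complex.linearYonedaObj ℤ N).d 0 0 x = 0
      rw [hd]; rfl)
    exact (cancel_epi (P.π.f 0)).1 (hx'.trans Limits.comp_zero.symm)
  · intro h x hx
    refine ⟨0, ?_⟩
    have : Epi (P.π.f 0) := inferInstance
    have h0 : P.exact₀.desc (A := N) x hx = 0 := @Subsingleton.elim (M ⟶ N) h _ _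
    have h1 : P.π.f 0 ≫ P.exact₀.desc (A := N) x hx = x := P.exact₀.g_desc (A := N) x hx
    rw [h0] at h1
    exact (map_zero _).trans (Limits.comp_zero.symm.trans h1)

lemma subsingleton_extGrp_succ_iff (M N : ModuleCat B) (n : ℕ) :
    Subsingleton (extGrp B (n + 1) M N) ↔ Subsingleton (Abelian.Ext M N (n + 1)) := by
  let P := ProjectiveResolution.of M
  rw [subsingleton_extGrp_iff_exactAt P,
    HomologicalComplex.exactAt_iff' _ n (n + 1) (n + 2) (by simp) (by simp),
    ShortComplex.moduleCat_exact_iff]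
  constructor
  · intro h
    refine subsingleton_of_forall_eq 0 fun x => ?_
    obtain ⟨f, hf, rfl⟩ := P.extMk_surjective x (n + 2) rfl
    exact (P.extMk_eq_zero_iff f _ rfl hf n rfl).2 (h f hf)
  · intro h f hf
    exact (P.extMk_eq_zero_iff f (n + 2) rfl hf n rfl).1 (Subsingleton.elim _ _)


section ShortExact

variable {X Y Z : Type} [AddCommGroup X] [AddCommGroup Y] [AddCommGroup Z]
  [Module B X] [Module B Y] [Module B Z] {f : X →ₗ[B] Y} {g : Y →ₗ[B] Z}

lemma exists_shortExact (hf : Function.Injective f) (hfg : Function.Exact f g)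
    (hg : Function.Surjective g) :
    ∃ w, (ShortComplex.mk (ModuleCat.ofHom f) (ModuleCat.ofHom g) w).ShortExact :=
  ⟨by ext x; exact hfg.apply_apply_eq_zero x,
    { exact := (ShortComplex.ShortExact.moduleCat_exact_iff_function_exact _).2 hfg
      mono_f := (ModuleCat.mono_iff_injective _).2 hf
      epi_g := (ModuleCat.epi_iff_surjective _).2 hg }⟩

/-- If `Ext¹(Y / X, N) = 0`, every homomorphism `X → N` extends to `Y`. -/
lemma exists_extension_of_subsingleton_extGrp (hf : Function.Injective f)
    (hfg : Function.Exact f g) (hg : Function.Surjective g) {N : Type} [AddCommGroup N]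
    [Module B N] (h : Subsingleton (extGrp B 1 (ModuleCat.of B Z) (ModuleCat.of B N)))
    (φ : X →ₗ[B] N) : ∃ ψ : Y →ₗ[B] N, ψ ∘ₗ f = φ := by
  obtain ⟨w, hS⟩ := exists_shortExact hf hfg hg
  rw [subsingleton_extGrp_succ_iff _ _ 0] at h
  obtain ⟨x, hx⟩ := Abelian.Ext.contravariant_sequence_exact₁ hS (ModuleCat.of B N)
    (Abelian.Ext.mk₀ (ModuleCat.ofHom φ)) (n₁ := 1) rfl (h.elim _ _)
  obtain ⟨ψ, rfl⟩ := Abelian.Ext.homEquiv₀.symm.surjective x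
  refine ⟨ψ.hom, ?_⟩
  have := Abelian.Ext.homEquiv₀.symm.injective
    ((Abelian.Ext.mk₀_comp_mk₀ _ _).symm.trans hx)
  exact congrArg ModuleCat.Hom.hom this

/-- Dimension shifting along a projective module. -/
lemma subsingleton_extGrp_of_subsingleton_extGrp_succ (hf : Function.Injective f)
    (hfg : Function.Exact f g) (hg : Function.Surjective g) [Module.Projective B Y]
    {N : ModuleCat B} (n : ℕ) (h : Subsingleton (extGrp B (n + 2) (ModuleCat.of B Z) N)) :
    Subsingleton (extGrp B (n + 1) (ModuleCat.of B X) N) := by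
  obtain ⟨w, hS⟩ := exists_shortExact hf hfg hg
  rw [subsingleton_extGrp_succ_iff] at h ⊢
  refine subsingleton_of_forall_eq 0 fun x => ?_
  obtain ⟨y, rfl⟩ := Abelian.Ext.contravariant_sequence_exact₁ hS N x (n₁ := n + 2)
    (by omega) (h.elim _ _)
  have : Projective (ModuleCat.of B Y) := inferInstance
  rw [Abelian.Ext.eq_zero_of_projective y, Abelian.Ext.comp_zero]

end ShortExact

end Homological

section Essential

variable {R M : Type} [Ring R] [AddCommGroup M] [Module R M]

/-- A submodule is essential if every nonzero element has a nonzero multiple inside it. -/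
def Submodule.IsEssential (N : Submodule R M) : Prop :=
  ∀ m : M, m ≠ 0 → ∃ r : R, r • m ∈ N ∧ r • m ≠ 0

lemma Submodule.IsEssential.mono {N N' : Submodule R M} (h : N.IsEssential) (hle : N ≤ N') :
    N'.IsEssential := fun m hm => by
  obtain ⟨r, h1, h2⟩ := h m hm
  exact ⟨r, hle h1, h2⟩

lemma Submodule.IsEssential.comap_toSpanSingleton {N : Submodule R M} (h : N.IsEssential)
    (m : M) : (N.comap (LinearMap.toSpanSingleton R M m)).IsEssential := fun a ha => by
  by_cases h0 : a • m = 0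
  · exact ⟨1, by simp [h0], by simpa using ha⟩
  · obtain ⟨r, h1, h2⟩ := h _ h0
    refine ⟨r, by simpa [mul_smul] using h1, fun h3 => h2 ?_⟩
    rw [← mul_smul, ← smul_eq_mul, h3, zero_smul]

/-- In a noetherian ring, an element without left annihilator generates an essential left
ideal. -/
lemma isEssential_span_singleton [IsNoetherianRing R] {c : R} (hc : ∀ t, t * c = 0 → t = 0) :
    (Ideal.span {c} : Submodule R R).IsEssential := by
  intro m hm
  by_contra! hcon
  let f : R × (Ideal.span {m} : Submodule R R) →ₗ[R] R :=
    (LinearMap.toSpanSingleton R R c).coprod (Submodule.subtype _)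
  have hf : Function.Injective f := by
    rw [injective_iff_map_eq_zero]
    rintro ⟨x, y, hy⟩ h
    obtain ⟨r, rfl⟩ := Ideal.mem_span_singleton'.1 hy
    have h' : x * c + r * m = 0 := h
    have hr : r * m = 0 := hcon r (Ideal.mem_span_singleton'.2
      ⟨-x, by rw [neg_mul]; exact (eq_neg_of_add_eq_zero_right h').symm⟩)
    rw [hr, add_zero] at h'
    ext
    · exact hc x h'
    · exact hr
  have := IsNoetherian.subsingleton_of_prod_injective f hf
  exact hm (congrArg Subtype.val (Subsingleton.elim
    (⟨m, Ideal.mem_span_singleton_self m⟩ : (Ideal.span {m} : Submodule R R)) 0))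

end Essential

section Goldie

variable {R : Type} [Ring R]

lemma exists_annihilator_pow_stable [IsNoetherianRing R] (x : R) :
    ∃ n, ∀ m, n ≤ m → ∀ t, t * x ^ m = 0 → t * x ^ n = 0 := by
  let f : ℕ →o Ideal R := ⟨fun n => Ideal.torsionOf R R (x ^ n), monotone_nat_of_le_succ
    fun n t ht => by
      simp only [Ideal.mem_torsionOf_iff, smul_eq_mul] at ht ⊢
      rw [pow_succ, ← mul_assoc, ht, zero_mul]⟩
  obtain ⟨n, hn⟩ := monotone_stabilizes_iff_noetherian.2 ‹_› f
  refine ⟨n, fun m hm t ht => ?_⟩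
  have : t ∈ f n := by rw [hn m hm]; exact ht
  exact this

lemma isNilpotent_of_isEssential_torsionOf [IsNoetherianRing R] {x : R}
    (hx : (Ideal.torsionOf R R x).IsEssential) : IsNilpotent x := by
  obtain ⟨n, hn⟩ := exists_annihilator_pow_stable x
  refine ⟨n, by_contra fun h0 => ?_⟩
  obtain ⟨r, h1, h2⟩ := hx _ h0
  refine h2 (hn (n + 1) n.le_succ r ?_)
  rw [pow_succ, ← mul_assoc]
  exact h1

/-- A prime noetherian ring has no nonzero nil left ideals. -/
lemma eq_zero_of_forall_isNilpotent_mul [IsNoetherianRing R] (hR : IsPrimeRing R) {a : R}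
    (ha : ∀ r, IsNilpotent (r * a)) : a = 0 := by
  by_contra ha0
  let S : Set (Ideal R) := {I | ∃ r, a * r ≠ 0 ∧ I = Ideal.torsionOf R R (a * r)}
  obtain ⟨_, ⟨r, hr0, rfl⟩, hmax⟩ := WellFounded.has_min (wellFounded_gt (α := Ideal R)) S
    ⟨_, 1, by simpa using ha0, rfl⟩
  set x := a * r with hx
  refine hr0 ((or_self_iff).1 (hR x x fun y => ?_))
  by_cases hxy : x * y = 0
  · rw [hxy, zero_mul]
  have hnil : IsNilpotent (x * y) := by
    obtain ⟨k, hk⟩ := ha (r * y)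
    refine ⟨k + 1, ?_⟩
    have h1 : ∀ k, (a * (r * y)) ^ (k + 1) = a * (r * y * a) ^ k * (r * y) := by
      intro k
      induction k with
      | zero => simp
      | succ k ih => rw [pow_succ, ih, pow_succ]; simp only [mul_assoc]
    rw [hx, mul_assoc, h1, hk, mul_zero, zero_mul]
  classical
  have hk := Nat.find_spec hnil
  have hlt := fun m => Nat.find_min hnil (m := m)
  generalize Nat.find hnil = k at hk hlt
  match k, hk, hlt with
  | 0, hk, _ =>
    rw [pow_zero] at hk
    rw [← mul_one (x * y * x), hk, mul_zero]
  | 1, hk, _ => exact absurd (by simpa using hk) hxy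
  | k + 2, hk, hlt =>
    have hne : (x * y) ^ (k + 1) ≠ 0 := hlt (k + 1) (by omega)
    have hform : (x * y) ^ (k + 1) = x * (y * (x * y) ^ k) := by rw [pow_succ', mul_assoc]
    have hle : Ideal.torsionOf R R x ≤ Ideal.torsionOf R R ((x * y) ^ (k + 1)) := by
      intro t ht
      simp only [Ideal.mem_torsionOf_iff, smul_eq_mul] at ht ⊢
      rw [hform, ← mul_assoc, ht, zero_mul]
    have hnlt := hmax (Ideal.torsionOf R R ((x * y) ^ (k + 1)))
      ⟨r * (y * (x * y) ^ k), by rw [← mul_assoc, ← hx, ← hform]; exact hne,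
        by rw [← mul_assoc, ← hx, ← hform]⟩
    have heq := eq_of_le_of_not_lt hle hnlt
    have hmem : x * y ∈ Ideal.torsionOf R R x := by
      rw [heq]
      exact (pow_succ' (x * y) (k + 1)).symm.trans hk
    exact hmem

/-- A prime noetherian ring is nonsingular. -/
lemma eq_zero_of_isEssential_torsionOf [IsNoetherianRing R] (hR : IsPrimeRing R) {x : R}
    (hx : (Ideal.torsionOf R R x).IsEssential) : x = 0 := by
  refine eq_zero_of_forall_isNilpotent_mul hR fun r => isNilpotent_of_isEssential_torsionOf ?_
  refine (hx.comap_toSpanSingleton r).mono fun t ht => ?_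
  have : t * r * x = 0 := ht
  simpa [mul_assoc] using this

/-- The right ideal of elements killed by every left annihilator of `c`. -/
def doubleAnnihilator (c : R) : Ideal Rᵐᵒᵖ where
  carrier := {y | ∀ t : R, t * c = 0 → t * y.unop = 0}
  add_mem' hx hy t ht := by simp [mul_add, hx t ht, hy t ht]
  zero_mem' t _ := by simp
  smul_mem' s y hy t ht := by simp [← mul_assoc, hy t ht]

/-- Goldie: in a prime noetherian ring, every essential left ideal contains a regular element. -/
theorem exists_mem_nonZeroDivisors_of_isEssential [IsNoetherianRing R] [IsNoetherianRing Rᵐᵒᵖ]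
    (hR : IsPrimeRing R) {I : Ideal R} (hI : Submodule.IsEssential I) :
    ∃ c ∈ I, c ∈ nonZeroDivisors R := by
  let S : Set (Ideal Rᵐᵒᵖ) :=
    {J | ∃ c ∈ I, (∀ t, t * c * c = 0 → t * c = 0) ∧ J = doubleAnnihilator c}
  obtain ⟨_, ⟨c, hcI, hc, rfl⟩, hmax⟩ := WellFounded.has_min (wellFounded_gt (α := Ideal Rᵐᵒᵖ)) S
    ⟨_, 0, I.zero_mem, by simp, rfl⟩
  have hdisj : ∀ a ∈ I, a * c = 0 → a = 0 := by
    intro a haI hac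
    by_contra ha0
    obtain ⟨r, hr⟩ : ∃ r, ¬ IsNilpotent (r * a) := by
      by_contra! h
      exact ha0 (eq_zero_of_forall_isNilpotent_mul hR h)
    obtain ⟨n, hn⟩ := exists_annihilator_pow_stable (r * a)
    obtain ⟨b, hb⟩ : ∃ b, b = (r * a) ^ (n + 1) := ⟨_, rfl⟩
    have hb0 : b ≠ 0 := fun h => hr ⟨n + 1, hb ▸ h⟩
    have hbI : b ∈ I := by
      rw [hb, pow_succ]
      exact I.mul_mem_left _ (I.mul_mem_left _ haI)
    have hbc : b * c = 0 := by
      rw [hb, pow_succ, mul_assoc, mul_assoc, hac, mul_zero, mul_zero]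
    have hbb : ∀ t, t * b * b = 0 → t * b = 0 := by
      intro t ht
      rw [hb, mul_assoc, ← pow_add] at ht
      rw [hb, pow_succ, ← mul_assoc, hn _ (by omega) t ht, zero_mul]
    have hsum : ∀ t, t * (c + b) = 0 → t * c = 0 ∧ t * b = 0 := by
      intro t ht
      rw [mul_add] at ht
      have h1 : t * c = 0 := by
        refine hc t ?_
        rw [eq_neg_of_add_eq_zero_left ht, neg_mul, mul_assoc, hbc, mul_zero, neg_zero]
      exact ⟨h1, by rwa [h1, zero_add] at ht⟩
    have hsq : ∀ t, t * (c + b) * (c + b) = 0 → t * (c + b) = 0 := by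
      intro t ht
      obtain ⟨h1, h2⟩ := hsum _ ht
      rw [mul_add, add_mul, mul_assoc t b c, hbc, mul_zero, add_zero] at h1
      have h3 := hc t h1
      rw [mul_add, h3, zero_add] at h2
      rw [mul_add, h3, hbb t h2, add_zero]
    have hle : doubleAnnihilator c ≤ doubleAnnihilator (c + b) :=
      fun y hy t ht => hy t (hsum t ht).1
    have heq := eq_of_le_of_not_lt hle (hmax _ ⟨c + b, I.add_mem hcI hbI, hsq, rfl⟩)
    have hmem : MulOpposite.op b ∈ doubleAnnihilator c := by
      rw [heq]
      exact fun t ht => (hsum t ht).2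
    have h4 : b * b = 0 := hmem b hbc
    exact hb0 (by simpa using hbb 1 (by simpa using h4))
  have hleft : ∀ t, t * c = 0 → t = 0 := by
    intro t ht
    by_contra ht0
    obtain ⟨r, h1, h2⟩ := hI t ht0
    exact h2 (hdisj _ h1 (by rw [smul_eq_mul, mul_assoc, ht, mul_zero]))
  refine ⟨c, hcI, fun y hy => ?_, hleft⟩
  refine eq_zero_of_isEssential_torsionOf hR ((isEssential_span_singleton hleft).mono ?_)
  refine (Ideal.span_singleton_le_iff_mem _).2 ?_
  exact hy

/-- The left Ore condition. -/
lemma exists_mul_eq_mul_left [IsNoetherianRing R] [IsNoetherianRing Rᵐᵒᵖ] (hR : IsPrimeRing R)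
    (j : R) {c : R} (hc : c ∈ nonZeroDivisors R) : ∃ d ∈ nonZeroDivisors R, ∃ y, d * j = y * c := by
  obtain ⟨d, hd, hd'⟩ := exists_mem_nonZeroDivisors_of_isEssential hR
    ((isEssential_span_singleton hc.2).comap_toSpanSingleton j)
  obtain ⟨y, hy⟩ := Ideal.mem_span_singleton'.1 (show d * j ∈ Ideal.span {c} from hd)
  exact ⟨d, hd', y, hy.symm⟩

lemma op_mem_nonZeroDivisors {c : R} (hc : c ∈ nonZeroDivisors R) :
    MulOpposite.op c ∈ nonZeroDivisors Rᵐᵒᵖ :=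
  ⟨fun _ hx => MulOpposite.unop_injective (hc.2 _ (congrArg MulOpposite.unop hx)),
    fun _ hx => MulOpposite.unop_injective (hc.1 _ (congrArg MulOpposite.unop hx))⟩

lemma unop_mem_nonZeroDivisors {c : Rᵐᵒᵖ} (hc : c ∈ nonZeroDivisors Rᵐᵒᵖ) :
    c.unop ∈ nonZeroDivisors R :=
  ⟨fun _ hx => MulOpposite.op_injective (hc.2 _ (congrArg MulOpposite.op hx)),
    fun _ hx => MulOpposite.op_injective (hc.1 _ (congrArg MulOpposite.op hx))⟩

lemma IsPrimeRing.op (hR : IsPrimeRing R) : IsPrimeRing Rᵐᵒᵖ := by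
  intro a b h
  have := hR b.unop a.unop fun x => by
    have := congrArg MulOpposite.unop (h (MulOpposite.op x))
    simpa [mul_assoc] using this
  simpa [or_comm] using this

lemma isNoetherianRing_op_op [IsNoetherianRing R] : IsNoetherianRing Rᵐᵒᵖᵐᵒᵖ :=
  isNoetherianRing_of_ringEquiv R (RingEquiv.opOp R)

/-- The right Ore condition. -/
lemma exists_mul_eq_mul_right [IsNoetherianRing R] [IsNoetherianRing Rᵐᵒᵖ] (hR : IsPrimeRing R)
    (j : R) {c : R} (hc : c ∈ nonZeroDivisors R) : ∃ d ∈ nonZeroDivisors R, ∃ y, j * d = c * y := by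
  have := isNoetherianRing_op_op (R := R)
  obtain ⟨d, hd, y, hy⟩ := exists_mul_eq_mul_left hR.op (MulOpposite.op j)
    (op_mem_nonZeroDivisors hc)
  exact ⟨d.unop, unop_mem_nonZeroDivisors hd, y.unop, congrArg MulOpposite.unop hy⟩

end Goldie

section Torsionless

variable {R X : Type} [Ring R] [IsNoetherianRing Rᵐᵒᵖ] [AddCommGroup X] [Module R X]

/-- Up to right multiplication by a regular element, a partial functional is compatible with
some functional on a cyclic submodule not contained in its domain. -/
lemma exists_compatible_value [IsNoetherianRing R] (hR : IsPrimeRing R)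
    (f : X →ₗ.[R] R) (hf : f.domain ≠ ⊤) :
    ∃ x ∉ f.domain, ∃ d ∈ nonZeroDivisors R, ∃ y₀ : R,
      ∀ (y : f.domain) (r : R), (y : X) = r • x → f y * d = r * y₀ := by
  by_cases hess : f.domain.IsEssential
  · obtain ⟨x, hx⟩ : ∃ x, x ∉ f.domain := by
      by_contra! h
      exact hf ((Submodule.eq_top_iff').2 h)
    obtain ⟨c, hcx, hc⟩ := exists_mem_nonZeroDivisors_of_isEssential hR
      (hess.comap_toSpanSingleton x)
    have hcx' : c • x ∈ f.domain := hcx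
    obtain ⟨d, hd, y₀, hy₀⟩ := exists_mul_eq_mul_right hR (f ⟨c • x, hcx'⟩) hc
    refine ⟨x, hx, d, hd, y₀, fun y r hy => ?_⟩
    obtain ⟨s, hs, t, hst⟩ := exists_mul_eq_mul_left hR r hc
    have h1 : s • y = t • (⟨c • x, hcx'⟩ : f.domain) := by
      ext
      simp only [Submodule.coe_smul, hy, ← mul_smul, hst]
    have h2 := congrArg f h1
    rw [f.map_smul, f.map_smul, smul_eq_mul, smul_eq_mul] at h2
    refine sub_eq_zero.1 (hs.1 _ ?_)
    rw [mul_sub, ← mul_assoc, h2, mul_assoc, hy₀, ← mul_assoc, ← mul_assoc, hst, sub_self]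
  · simp only [Submodule.IsEssential] at hess
    push Not at hess
    obtain ⟨x, hx0, hx⟩ := hess
    refine ⟨x, fun h => hx0 (by simpa using hx 1 (by simpa using h)), 1, one_mem _, 0,
      fun y r hy => ?_⟩
    have : y = 0 := Subtype.ext (hy.trans (hx r (hy ▸ y.2)))
    rw [this, f.map_zero, zero_mul, mul_zero]

/-- A partial functional extends to a functional, up to right multiplication by a regular
element. -/
lemma exists_extension_mul_nonZeroDivisor [IsNoetherianRing R] [IsNoetherian R X] (hR : IsPrimeRing R)
    (g : X →ₗ.[R] R) :
    ∃ d ∈ nonZeroDivisors R, ∃ h : X →ₗ[R] R, ∀ y : g.domain, h y = g y * d := by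
  let S : Set (Submodule R X) := {D | ∃ f : X →ₗ.[R] R, f.domain = D ∧
    ∃ d ∈ nonZeroDivisors R, ∀ y : g.domain, ∃ y' : f.domain, (y' : X) = y ∧ f y' = g y * d}
  obtain ⟨_, ⟨f, rfl, d, hd, hfg⟩, hmax⟩ :=
    WellFounded.has_min (wellFounded_gt (α := Submodule R X)) S
      ⟨_, g, rfl, 1, one_mem _, fun y => ⟨y, rfl, (mul_one _).symm⟩⟩
  have htop : f.domain = ⊤ := by
    by_contra hne
    obtain ⟨x, hx, e, he, y₀, hcomp⟩ := exists_compatible_value hR f hne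
    let f₁ : X →ₗ.[R] R := (LinearMap.toSpanSingleton R R e).compPMap f
    let f₂ : X →ₗ.[R] R := LinearPMap.mkSpanSingleton' x y₀ fun c hc => by
      have := hcomp 0 c hc.symm
      rw [f.map_zero, zero_mul] at this
      exact this.symm
    have H : ∀ (y : f₁.domain) (z : f₂.domain), (y : X) = z → f₁ y = f₂ z := by
      rintro y ⟨z, hz⟩ hyz
      obtain ⟨r, rfl⟩ := Submodule.mem_span_singleton.1 hz
      rw [LinearPMap.mkSpanSingleton'_apply]
      exact hcomp y r hyz
    refine hmax (f₁.sup f₂ H).domain ⟨_, rfl, d * e, mul_mem hd he, fun y => ?_⟩ ?_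
    · obtain ⟨y', hy', hfy'⟩ := hfg y
      refine ⟨⟨y', (le_sup_left : f₁.domain ≤ f₁.domain ⊔ f₂.domain) y'.2⟩, hy', ?_⟩
      rw [← (LinearPMap.left_le_sup f₁ f₂ H).2 (x := y') rfl]
      change f y' * e = _
      rw [hfy', mul_assoc]
    · refine lt_of_le_not_ge (le_sup_left : f₁.domain ≤ f₁.domain ⊔ f₂.domain) fun hle => hx ?_
      exact hle ((le_sup_right : f₂.domain ≤ f₁.domain ⊔ f₂.domain)
        (Submodule.mem_span_singleton_self x))
  refine ⟨d, hd, f.toFun ∘ₗ LinearMap.codRestrict f.domain LinearMap.id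
    (fun x => htop ▸ Submodule.mem_top), fun y => ?_⟩
  obtain ⟨y', hy', h⟩ := hfg y
  rw [← h]
  exact congrArg f (Subtype.ext hy'.symm)

/-- Functionals separate points of a torsionfree noetherian module over a prime noetherian
ring. -/
lemma exists_functional_ne_zero [IsNoetherianRing R] [IsNoetherian R X] (hR : IsPrimeRing R)
    (hX : ∀ m : X, m ≠ 0 → ∀ a ∈ nonZeroDivisors R, a • m ≠ 0) {u : X} (hu : u ≠ 0) :
    ∃ h : X →ₗ[R] R, h u ≠ 0 := by
  have hess : ¬ (Ideal.torsionOf R X u).IsEssential := fun h => by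
    obtain ⟨c, hc, hc'⟩ := exists_mem_nonZeroDivisors_of_isEssential hR h
    exact hX u hu c hc' hc
  simp only [Submodule.IsEssential] at hess
  push Not at hess
  obtain ⟨b, hb0, hb⟩ := hess
  obtain ⟨d, hd, h, hh⟩ := exists_extension_mul_nonZeroDivisor hR
    (LinearPMap.mkSpanSingleton' (σ := RingHom.id R) (b • u) b fun c hc =>
      hb c (by simpa [mul_smul] using hc))
  refine ⟨h, fun h0 => hb0 (hd.2 b ?_)⟩
  have := (hh ⟨b • u, Submodule.mem_span_singleton_self _⟩).trans
    (congrArg (· * d) (LinearPMap.mkSpanSingleton'_apply_self _ _ _ _))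
  rw [map_smul, h0, smul_zero] at this
  exact this.symm

/-- A finitely generated torsionless module embeds in a finitely generated free module. -/
lemma exists_injective_pi [Module.Finite R X]
    (hX : ∀ u : X, u ≠ 0 → ∃ h : X →ₗ[R] R, h u ≠ 0) :
    ∃ (n : ℕ) (f : X →ₗ[R] (Fin n → R)), Function.Injective f := by
  obtain ⟨m, x, hx⟩ := Module.Finite.exists_fin (R := R) (M := X)
  have : IsNoetherian Rᵐᵒᵖ R :=
    isNoetherian_of_linearEquiv (MulOpposite.opLinearEquiv Rᵐᵒᵖ (M := R)).symm
  let ev : (X →ₗ[R] R) →ₗ[Rᵐᵒᵖ] (Fin m → R) :=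
    { toFun := fun φ i => φ (x i)
      map_add' := fun _ _ => rfl
      map_smul' := fun _ _ => rfl }
  have hev : Function.Injective ev := fun φ ψ h =>
    LinearMap.ext_on_range hx fun i => congrFun h i
  have := isNoetherian_of_injective ev hev
  obtain ⟨n, φ, hφ⟩ := Module.Finite.exists_fin (R := Rᵐᵒᵖ) (M := X →ₗ[R] R)
  refine ⟨n, LinearMap.pi φ, (injective_iff_map_eq_zero _).2 fun u hu => by_contra fun h0 => ?_⟩
  obtain ⟨h, hh⟩ := hX u h0
  refine hh ?_
  clear hh
  have hmem : h ∈ Submodule.span Rᵐᵒᵖ (Set.range φ) := hφ ▸ Submodule.mem_top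
  induction hmem using Submodule.span_induction with
  | mem ψ hψ =>
    obtain ⟨i, rfl⟩ := hψ
    exact congrFun hu i
  | zero => rfl
  | add ψ χ _ _ h1 h2 => simp [h1, h2]
  | smul a ψ _ h1 => simp [h1]

end Torsionless

section Duality

variable {A : Type} [Ring A]

/-- A functional on the dual of a finitely generated free right module is an evaluation. -/
lemma exists_eq_eval_of_dual_pi {n : ℕ} (Φ : ((Fin n → Aᵐᵒᵖ) →ₗ[Aᵐᵒᵖ] A) →ₗ[A] A) :
    ∃ z, ∀ l, Φ l = l z := by
  let coord : Fin n → (Fin n → Aᵐᵒᵖ) →ₗ[Aᵐᵒᵖ] A := fun i =>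
    (MulOpposite.opLinearEquiv Aᵐᵒᵖ (M := A)).symm.toLinearMap ∘ₗ LinearMap.proj i
  have hl : ∀ l : (Fin n → Aᵐᵒᵖ) →ₗ[Aᵐᵒᵖ] A,
      l = ∑ i, l (Pi.single i 1) • coord i := by
    intro l
    refine LinearMap.pi_ext' fun i => LinearMap.ext_ring ?_
    simp [coord, Pi.single_apply, apply_ite MulOpposite.unop]
  refine ⟨fun i => MulOpposite.op (Φ (coord i)), fun l => ?_⟩
  conv_lhs => rw [hl l]
  conv_rhs => rw [hl l]
  simp [coord, LinearMap.sum_apply]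

/-- Over a right noetherian ring of left injective dimension at most one, a finitely generated
right module `M` with `Hom(M, A) = 0` and `Ext¹(M, A) = 0` vanishes. -/
theorem subsingleton_of_subsingleton_dual_of_subsingleton_extGrp_one [IsNoetherianRing Aᵐᵒᵖ]
    (hA : LeftSelfInjDimLE A 1) {M : Type} [AddCommGroup M] [Module Aᵐᵒᵖ M]
    [Module.Finite Aᵐᵒᵖ M] (h0 : Subsingleton (M →ₗ[Aᵐᵒᵖ] A))
    (h1 : Subsingleton (extGrp Aᵐᵒᵖ 1 (ModuleCat.of Aᵐᵒᵖ M) (ModuleCat.of Aᵐᵒᵖ Aᵐᵒᵖ))) :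
    Subsingleton M := by
  let e := MulOpposite.opLinearEquiv Aᵐᵒᵖ (M := A)
  obtain ⟨n₀, p, hp⟩ := Module.Finite.exists_fin' Aᵐᵒᵖ M
  obtain ⟨n₁, q, hq⟩ := Module.Finite.exists_fin' Aᵐᵒᵖ (LinearMap.ker p)
  obtain ⟨m, k, hk⟩ := Module.Finite.exists_fin (R := Aᵐᵒᵖ) (M := LinearMap.ker q)
  let d : ((Fin n₀ → Aᵐᵒᵖ) →ₗ[Aᵐᵒᵖ] A) →ₗ[A] ((Fin n₁ → Aᵐᵒᵖ) →ₗ[Aᵐᵒᵖ] A) :=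
    { toFun := fun l => l ∘ₗ (LinearMap.ker p).subtype ∘ₗ q
      map_add' := fun _ _ => rfl
      map_smul' := fun _ _ => rfl }
  let ev : ((Fin n₁ → Aᵐᵒᵖ) →ₗ[Aᵐᵒᵖ] A) →ₗ[A] (Fin m → A) :=
    { toFun := fun l i => l (k i)
      map_add' := fun _ _ => rfl
      map_smul' := fun _ _ => rfl }
  have hd : Function.Injective d := by
    refine (injective_iff_map_eq_zero _).2 fun l hl => ?_
    have hker : LinearMap.ker p ≤ LinearMap.ker l := by
      intro x hx
      obtain ⟨y, hy⟩ := hq ⟨x, hx⟩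
      have h2 : l (q y) = 0 := LinearMap.congr_fun hl y
      rwa [hy] at h2
    let l' := (LinearMap.ker p).liftQ l hker ∘ₗ
      (p.quotKerEquivOfSurjective hp).symm.toLinearMap
    refine LinearMap.ext fun x => ?_
    have h2 : l' (p x) = 0 := LinearMap.congr_fun (Subsingleton.elim l' 0) (p x)
    simpa [l'] using h2
  have hexact : Function.Exact d ev.rangeRestrict := by
    intro l
    constructor
    · intro hl
      have hl' : ∀ i, l (k i) = 0 := fun i => congrFun (congrArg Subtype.val hl) i
      have hker : LinearMap.ker q ≤ LinearMap.ker l := by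
        intro x hx
        have h2 : l ∘ₗ (LinearMap.ker q).subtype = 0 :=
          LinearMap.ext_on_range hk fun i => hl' i
        exact LinearMap.congr_fun h2 ⟨x, hx⟩
      let μ := (LinearMap.ker q).liftQ l hker ∘ₗ
        (q.quotKerEquivOfSurjective hq).symm.toLinearMap
      obtain ⟨ψ, hψ⟩ := exists_extension_of_subsingleton_extGrp
        (LinearMap.ker p).injective_subtype (LinearMap.exact_subtype_ker_map p) hp h1
        (e.toLinearMap ∘ₗ μ)
      refine ⟨e.symm.toLinearMap ∘ₗ ψ, LinearMap.ext fun x => ?_⟩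
      have h2 : ψ (q x) = e (μ (q x)) := LinearMap.congr_fun hψ (q x)
      change e.symm (ψ (q x)) = l x
      rw [h2, LinearEquiv.symm_apply_apply]
      simp [μ]
    · rintro ⟨l, rfl⟩
      refine Subtype.ext (funext fun i => ?_)
      change l (q (k i)) = 0
      rw [(k i).2]
      simp
  have hC := subsingleton_extGrp_of_subsingleton_extGrp_succ (LinearMap.range ev).injective_subtype
    (LinearMap.exact_subtype_mkQ _) (Submodule.mkQ_surjective _) 0
    (hA (ModuleCat.of A ((Fin m → A) ⧸ LinearMap.range ev)) 2 (by omega))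
  refine subsingleton_of_forall_eq 0 fun y => ?_
  obtain ⟨x, rfl⟩ := hp y
  obtain ⟨Φ, hΦ⟩ := exists_extension_of_subsingleton_extGrp hd hexact
    ev.surjective_rangeRestrict hC
    { toFun := fun l => l x
      map_add' := fun _ _ => rfl
      map_smul' := fun _ _ => rfl }
  obtain ⟨z, hz⟩ := exists_eq_eval_of_dual_pi Φ
  have hx : x = q z := by
    ext1 i
    have h2 := (hz _).symm.trans (LinearMap.congr_fun hΦ (e.symm.toLinearMap ∘ₗ LinearMap.proj i))
    exact (e.symm.injective h2).symm
  rw [hx]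
  exact (q z).2

end Duality

/-- A finitely generated torsionless module has no higher extensions by a ring of injective
dimension at most one. -/
lemma subsingleton_extGrp_one_of_injective {B X : Type} [Ring B] [AddCommGroup X] [Module B X]
    {N : ModuleCat B} (hN : ∀ M : ModuleCat B, Subsingleton (extGrp B 2 M N)) {n : ℕ}
    {f : X →ₗ[B] (Fin n → B)} (hf : Function.Injective f) :
    Subsingleton (extGrp B 1 (ModuleCat.of B X) N) :=
  subsingleton_extGrp_of_subsingleton_extGrp_succ hf (LinearMap.exact_map_mkQ_range f)
    (Submodule.mkQ_surjective _) 0 (hN _)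

theorem stmt_1 (A : Type) [Ring A]
    (hprime : IsPrimeRing A)
    (hnoethR : IsNoetherianRing Aᵐᵒᵖ) (hnoethL : IsNoetherianRing A)
    (hinjR : RightSelfInjDimLE A 1) (hinjL : LeftSelfInjDimLE A 1)
    (hinjR' : ¬ RightSelfInjDimLE A 0) :
    (∀ (M : Type) [AddCommGroup M] [Module Aᵐᵒᵖ M] [Module.Finite Aᵐᵒᵖ M],
        Nontrivial M → RightTorsion A M →
        ∀ n : ℕ,
          Nontrivial (extGrp Aᵐᵒᵖ n (ModuleCat.of Aᵐᵒᵖ M) (ModuleCat.of Aᵐᵒᵖ Aᵐᵒᵖ)) ↔ n = 1) ∧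
    (∀ (P : Type) [AddCommGroup P] [Module Aᵐᵒᵖ P] [Module.Finite Aᵐᵒᵖ P],
        Nontrivial P → RightTorsionFree A P →
        ∀ n : ℕ,
          Nontrivial (extGrp Aᵐᵒᵖ n (ModuleCat.of Aᵐᵒᵖ P) (ModuleCat.of Aᵐᵒᵖ Aᵐᵒᵖ)) ↔ n = 0) := by
  constructor
  · intro M _ _ _ hM htors n
    have hhom : ∀ f : M →ₗ[Aᵐᵒᵖ] Aᵐᵒᵖ, f = 0 := by
      intro f
      ext1 x
      obtain ⟨a, ha, hax⟩ := htors x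
      refine (op_mem_nonZeroDivisors ha).1 _ ?_
      rw [← smul_eq_mul, ← map_smul, hax, map_zero]
    match n with
    | 0 =>
      rw [← not_subsingleton_iff_nontrivial, subsingleton_extGrp_zero_iff]
      refine iff_of_false (not_not.2 (subsingleton_of_forall_eq 0 fun f => ?_)) zero_ne_one
      exact ModuleCat.hom_ext (hhom f.hom)
    | 1 =>
      rw [← not_subsingleton_iff_nontrivial]
      refine iff_of_true (fun h1 => ?_) rfl
      refine not_subsingleton_iff_nontrivial.2 hM
        (subsingleton_of_subsingleton_dual_of_subsingleton_extGrp_one hinjL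
          (subsingleton_of_forall_eq 0 fun f => ?_) h1)
      ext1 x
      exact MulOpposite.op_injective (LinearMap.congr_fun
        (hhom ((MulOpposite.opLinearEquiv Aᵐᵒᵖ (M := A)).toLinearMap ∘ₗ f)) x)
    | n + 2 =>
      rw [← not_subsingleton_iff_nontrivial]
      exact iff_of_false (not_not.2 (hinjR _ _ (by omega))) (by omega)
  · intro P _ _ _ hP htf n
    have := isNoetherianRing_op_op (R := A)
    have hsep : ∀ u : P, u ≠ 0 → ∃ h : P →ₗ[Aᵐᵒᵖ] Aᵐᵒᵖ, h u ≠ 0 := fun u hu =>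
      exists_functional_ne_zero hprime.op
        (fun m hm a ha => htf m hm a.unop (unop_mem_nonZeroDivisors ha)) hu
    match n with
    | 0 =>
      rw [← not_subsingleton_iff_nontrivial, subsingleton_extGrp_zero_iff]
      refine iff_of_true (fun hs => ?_) rfl
      obtain ⟨u, hu⟩ := exists_ne (0 : P)
      obtain ⟨h, hh⟩ := hsep u hu
      have h0 : ModuleCat.ofHom h = 0 := Subsingleton.elim _ _
      exact hh (LinearMap.congr_fun (congrArg ModuleCat.Hom.hom h0) u)
    | 1 =>
      rw [← not_subsingleton_iff_nontrivial]
      obtain ⟨m, f, hf⟩ := exists_injective_pi hsep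
      exact iff_of_false (not_not.2 (subsingleton_extGrp_one_of_injective
        (fun M => hinjR M 2 (by omega)) hf)) one_ne_zero
    | n + 2 =>
      rw [← not_subsingleton_iff_nontrivial]
      exact iff_of_false (not_not.2 (hinjR _ _ (by omega))) (by omega)
end

section
/- Let A be a prime noetherian ring of injective dimension one that either is hereditary or has an A_1 singularity, and let C be a right A-module with A ⊂ C ⊂ Fr(A) such that S := C/A is a simple right A-module. Then either S has finite projective dimension, or there exists a finitely generated right A-module X of finite projective dimension fitting into a short exact sequence 0 → S → X → S → 0. -/
/-- `A` is (right) hereditary: right global dimension at most one. -/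
def IsHereditaryRing (A : Type) [Ring A] : Prop :=
  ∀ (M N : ModuleCat Aᵐᵒᵖ) (n : ℕ), 1 < n → Subsingleton (extGrp Aᵐᵒᵖ n M N)

/-- A right `A`-module is maximal Cohen--Macaulay if `Ext^n(M, A) = 0` for all `n > 0`. -/
def IsMCM (A : Type) [Ring A] (M : Type) [AddCommGroup M] [Module Aᵐᵒᵖ M] : Prop :=
  ∀ n : ℕ, 0 < n →
    Subsingleton (extGrp Aᵐᵒᵖ n (ModuleCat.of Aᵐᵒᵖ M) (ModuleCat.of Aᵐᵒᵖ Aᵐᵒᵖ))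

/-- A map of right `A`-modules factors through a projective module. -/
def FactorsThroughProjective (A : Type) [Ring A] {M N : Type}
    [AddCommGroup M] [Module Aᵐᵒᵖ M] [AddCommGroup N] [Module Aᵐᵒᵖ N]
    (f : M →ₗ[Aᵐᵒᵖ] N) : Prop :=
  ∃ (P : ModuleCat.{0} Aᵐᵒᵖ), Module.Projective Aᵐᵒᵖ P ∧
    ∃ (u : M →ₗ[Aᵐᵒᵖ] P) (v : P →ₗ[Aᵐᵒᵖ] N), v ∘ₗ u = f

/-- Two right `A`-modules are stably isomorphic (isomorphic in the stable category). -/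
def StablyIso (A : Type) [Ring A] (M N : Type)
    [AddCommGroup M] [Module Aᵐᵒᵖ M] [AddCommGroup N] [Module Aᵐᵒᵖ N] : Prop :=
  ∃ (P Q : ModuleCat.{0} Aᵐᵒᵖ), Module.Projective Aᵐᵒᵖ P ∧ Module.Projective Aᵐᵒᵖ Q ∧
    Module.Finite Aᵐᵒᵖ P ∧ Module.Finite Aᵐᵒᵖ Q ∧
    Nonempty ((M × P) ≃ₗ[Aᵐᵒᵖ] (N × Q))

/-- The `k`-scalar endomorphism `m ↦ algebraMap k Aᵐᵒᵖ c • m` of a right `A`-module. -/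
def scalarEndo (k A : Type) [CommRing k] [Ring A] [Algebra k A] (M : Type)
    [AddCommGroup M] [Module Aᵐᵒᵖ M] (c : k) : M →ₗ[Aᵐᵒᵖ] M where
  toFun m := (algebraMap k Aᵐᵒᵖ c) • m
  map_add' m m' := smul_add _ m m'
  map_smul' a m := by
    simp only [RingHom.id_apply, ← mul_smul, Algebra.commutes]

/-- `M` is a generator of the singularity category of `A`, which is equivalent to the category
of `k`-vector spaces with trivial shift (an `A_1` singularity). -/
def IsA1Generator (k A : Type) [Field k] [Ring A] [Algebra k A] (M : Type)
    [AddCommGroup M] [Module Aᵐᵒᵖ M] : Prop :=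
  Module.Finite Aᵐᵒᵖ M ∧ IsMCM A M ∧ ¬ Module.Projective Aᵐᵒᵖ M ∧
  -- every MCM module is stably isomorphic to a direct sum of copies of `M`:
  (∀ (N : ModuleCat Aᵐᵒᵖ), Module.Finite Aᵐᵒᵖ N → IsMCM A N →
      ∃ s : ℕ, StablyIso A N (Fin s → M)) ∧
  -- the stable endomorphism ring of `M` is `k`:
  (∀ f : M →ₗ[Aᵐᵒᵖ] M, ∃ c : k, FactorsThroughProjective A (f - scalarEndo k A M c)) ∧
  (∀ c : k, c ≠ 0 → ¬ FactorsThroughProjective A (scalarEndo k A M c)) ∧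
  -- the first syzygy of `M` is stably isomorphic to `M`:
  (∃ (P : ModuleCat.{0} Aᵐᵒᵖ) (p : P →ₗ[Aᵐᵒᵖ] M), Module.Projective Aᵐᵒᵖ P ∧
      Module.Finite Aᵐᵒᵖ P ∧ Function.Surjective p ∧ StablyIso A (LinearMap.ker p) M)

/-- `A` has an `A_1` singularity. -/
def HasA1Singularity (k A : Type) [Field k] [Ring A] [Algebra k A] : Prop :=
  ∃ M : ModuleCat Aᵐᵒᵖ, IsA1Generator k A M


/-- A right `A`-module has finite projective dimension. -/
def RightFinProjDim (A : Type) [Ring A] (M : Type) [AddCommGroup M] [Module Aᵐᵒᵖ M] : Prop :=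
  ∃ d : ℕ, ∀ (N : ModuleCat Aᵐᵒᵖ) (n : ℕ), d < n →
    Subsingleton (extGrp Aᵐᵒᵖ n (ModuleCat.of Aᵐᵒᵖ M) N)

open CategoryTheory

lemma subsingleton_extGrp_succ_iff_s4 {B : Type} [Ring B] (n : ℕ) {M : ModuleCat.{0} B}
    (N : ModuleCat.{0} B) (P : ProjectiveResolution M) :
    Subsingleton (extGrp B (n + 1) M N) ↔
      ∀ f : P.complex.X (n + 1) ⟶ N, P.complex.d (n + 2) (n + 1) ≫ f = 0 →
        ∃ g : P.complex.X n ⟶ N, P.complex.d (n + 1) n ≫ g = f := by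
  rw [← ModuleCat.isZero_iff_subsingleton,
    (P.isoExt (R := ℤ) (n + 1) N).isZero_iff,
    ← HomologicalComplex.exactAt_iff_isZero_homology,
    HomologicalComplex.exactAt_iff' _ n (n + 1) (n + 2) (by simp) (by simp),
    ShortComplex.moduleCat_exact_iff]
  rfl

lemma subsingleton_abelianExt_succ_iff {B : Type} [Ring B] (n : ℕ) {M : ModuleCat.{0} B}
    (N : ModuleCat.{0} B) (P : ProjectiveResolution M) :
    Subsingleton (Abelian.Ext.{0} M N (n + 1)) ↔
      ∀ f : P.complex.X (n + 1) ⟶ N, P.complex.d (n + 2) (n + 1) ≫ f = 0 →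
        ∃ g : P.complex.X n ⟶ N, P.complex.d (n + 1) n ≫ g = f := by
  refine ⟨fun h f hf ↦ (P.extMk_eq_zero_iff f (n + 2) rfl hf n rfl).1 (Subsingleton.elim _ _),
    fun h ↦ subsingleton_of_forall_eq 0 fun x ↦ ?_⟩
  obtain ⟨f, hf, rfl⟩ := P.extMk_surjective x (n + 2) rfl
  exact (P.extMk_eq_zero_iff f (n + 2) rfl hf n rfl).2 (h f hf)

lemma subsingleton_extGrp_iff {B : Type} [Ring B] {n : ℕ} (hn : 0 < n) (M N : ModuleCat.{0} B) :
    Subsingleton (extGrp B n M N) ↔ Subsingleton (Abelian.Ext.{0} M N n) := by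
  obtain ⟨n, rfl⟩ := Nat.exists_eq_succ_of_ne_zero hn.ne'
  let P := projectiveResolution M
  rw [subsingleton_extGrp_succ_iff_s4 n N P, subsingleton_abelianExt_succ_iff n N P]

lemma rightFinProjDim_of_exact {A : Type} [Ring A] {P Q X : Type} [AddCommGroup P]
    [Module Aᵐᵒᵖ P] [AddCommGroup Q] [Module Aᵐᵒᵖ Q] [AddCommGroup X] [Module Aᵐᵒᵖ X]
    [Module.Projective Aᵐᵒᵖ P] [Module.Projective Aᵐᵒᵖ Q]
    (f : P →ₗ[Aᵐᵒᵖ] Q) (g : Q →ₗ[Aᵐᵒᵖ] X) (hf : Function.Injective f)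
    (hg : Function.Surjective g) (hfg : Function.Exact f g) : RightFinProjDim A X := by
  refine ⟨1, fun N n hn ↦ (subsingleton_extGrp_iff (by omega) _ _).2 ?_⟩
  obtain ⟨m, rfl⟩ : ∃ m, n = 1 + (m + 1) := ⟨n - 2, by omega⟩
  let S : ShortComplex (ModuleCat.{0} Aᵐᵒᵖ) :=
    ModuleCat.shortComplexOfCompEqZero f g hfg.linearMap_comp_eq_zero
  have hS : S.ShortExact :=
    { exact := (ShortComplex.ShortExact.moduleCat_exact_iff_function_exact S).2 hfg
      mono_f := (ModuleCat.mono_iff_injective _).2 hf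
      epi_g := (ModuleCat.epi_iff_surjective _).2 hg }
  have : Projective S.X₁ := (IsProjective.iff_projective P).1 inferInstance
  have : Projective S.X₂ := (IsProjective.iff_projective Q).1 inferInstance
  refine subsingleton_of_forall_eq 0 fun x ↦ ?_
  obtain ⟨y, rfl⟩ := Abelian.Ext.contravariant_sequence_exact₃ hS N x
    (Abelian.Ext.eq_zero_of_projective _) rfl
  rw [Abelian.Ext.eq_zero_of_projective y, Abelian.Ext.comp_zero]

lemma isMCM_of_injective {A : Type} [Ring A] (hA : RightSelfInjDimLE A 1) {C F : Type}
    [AddCommGroup C] [Module Aᵐᵒᵖ C] [AddCommGroup F] [Module Aᵐᵒᵖ F] [Module.Projective Aᵐᵒᵖ F]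
    (f : C →ₗ[Aᵐᵒᵖ] F) (hf : Function.Injective f) : IsMCM A C := by
  intro n hn
  refine (subsingleton_extGrp_iff hn _ _).2 ?_
  obtain ⟨m, rfl⟩ := Nat.exists_eq_succ_of_ne_zero hn.ne'
  let S : ShortComplex (ModuleCat.{0} Aᵐᵒᵖ) :=
    ModuleCat.shortComplexOfCompEqZero f (LinearMap.range f).mkQ (LinearMap.range_mkQ_comp f)
  have hS : S.ShortExact :=
    { exact := (ShortComplex.ShortExact.moduleCat_exact_iff_function_exact S).2
        (LinearMap.exact_map_mkQ_range f)
      mono_f := (ModuleCat.mono_iff_injective _).2 hf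
      epi_g := (ModuleCat.epi_iff_surjective _).2 (Submodule.mkQ_surjective _) }
  have : Projective S.X₂ := (IsProjective.iff_projective F).1 inferInstance
  have hX₃ := (subsingleton_extGrp_iff (by omega) _ _).1 (hA S.X₃ (1 + (m + 1)) (by omega))
  refine subsingleton_of_forall_eq 0 fun x ↦ ?_
  obtain ⟨y, rfl⟩ := Abelian.Ext.contravariant_sequence_exact₁ hS _ x rfl (Subsingleton.elim _ _)
  rw [Abelian.Ext.eq_zero_of_projective y, Abelian.Ext.comp_zero]

/-- A left ideal is essential if it meets every nonzero principal left ideal nontrivially. -/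
def IsEssentialLeftIdeal {R : Type} [Ring R] (E : Ideal R) : Prop :=
  ∀ y : R, y ≠ 0 → ∃ r : R, r * y ∈ E ∧ r * y ≠ 0

lemma IsEssentialLeftIdeal.mono {R : Type} [Ring R] {E F : Ideal R}
    (hE : IsEssentialLeftIdeal E) (h : E ≤ F) : IsEssentialLeftIdeal F := fun y hy ↦
  let ⟨r, hr, hr'⟩ := hE y hy
  ⟨r, h hr, hr'⟩

lemma IsEssentialLeftIdeal.comap_mul_right {R : Type} [Ring R] {E : Ideal R}
    (hE : IsEssentialLeftIdeal E) (b : R) :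
    IsEssentialLeftIdeal (Submodule.comap (LinearMap.toSpanSingleton R R b) E) := by
  intro y hy
  by_cases hyb : y * b = 0
  · exact ⟨1, by simp [hyb], by simpa⟩
  · obtain ⟨r, hr, hr'⟩ := hE (y * b) hyb
    refine ⟨r, by simpa [mul_assoc] using hr, fun h ↦ hr' ?_⟩
    rw [← mul_assoc, h, zero_mul]

lemma isEssentialLeftIdeal_span_singleton {R : Type} [Ring R] [IsNoetherianRing R] {a : R}
    (ha : ∀ x, x * a = 0 → x = 0) : IsEssentialLeftIdeal (Ideal.span {a}) := by
  intro y hy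
  by_contra! h
  let f : R × Submodule.span R {y} →ₗ[R] R :=
    (LinearMap.toSpanSingleton R R a).coprod (Submodule.span R {y}).subtype
  have hf : Function.Injective f := by
    rw [injective_iff_map_eq_zero]
    rintro ⟨x, u, hu⟩ hxu
    obtain ⟨r, rfl⟩ := Submodule.mem_span_singleton.1 hu
    replace hxu : x * a + r * y = 0 := by simpa [f] using hxu
    have hry : r * y = 0 := h r <| by
      rw [eq_neg_of_add_eq_zero_right hxu]
      exact neg_mem (Ideal.mul_mem_left _ _ (Ideal.mem_span_singleton_self a))
    rw [hry, add_zero] at hxu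
    simp [ha x hxu, hry]
  have e := IsNoetherian.equivPUnitOfProdInjective f hf
  have := e.toEquiv.subsingleton
  exact hy (congrArg Subtype.val (Subsingleton.elim
    (⟨y, Submodule.mem_span_singleton_self y⟩ : Submodule.span R {y}) 0))

/-- The left singular ideal of a prime left noetherian ring is zero. -/
lemma IsPrimeRing.eq_zero_of_isEssentialLeftIdeal_ker {R : Type} [Ring R] [IsNoetherianRing R]
    (hR : IsPrimeRing R) {z : R}
    (hz : IsEssentialLeftIdeal (LinearMap.ker (LinearMap.toSpanSingleton R R z))) : z = 0 := by
  by_contra hz0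
  let ann : R → Ideal R := fun z ↦ LinearMap.ker (LinearMap.toSpanSingleton R R z)
  obtain ⟨_, ⟨w, hw0, hw, rfl⟩, hmax⟩ := (wellFounded_gt (α := Ideal R)).has_min
    {I | ∃ w, w ≠ 0 ∧ IsEssentialLeftIdeal (ann w) ∧ ann w = I} ⟨_, z, hz0, hz, rfl⟩
  refine hw0 ((or_self_iff).1 (hR w w fun r ↦ ?_))
  by_contra hr
  have hle : ann w ≤ ann (w * r * w) := fun x hx ↦ by
    have hx : x * w = 0 := by simpa [ann] using hx
    simp [ann, ← mul_assoc, hx]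
  refine hmax _ ⟨_, hr, hw.mono hle, rfl⟩ (lt_of_le_not_ge hle fun hge ↦ ?_)
  obtain ⟨y, hy, hy'⟩ := hw.comap_mul_right r w hw0
  refine hy' ?_
  have : y ∈ ann w := hge (by simpa [ann, mul_assoc] using hy)
  simpa [ann] using this

lemma IsPrimeRing.mulOpposite {R : Type} [Ring R] (hR : IsPrimeRing R) : IsPrimeRing Rᵐᵒᵖ := by
  intro a b h
  refine (hR b.unop a.unop fun x ↦ ?_).symm.imp (MulOpposite.unop_eq_zero_iff a).1
    (MulOpposite.unop_eq_zero_iff b).1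
  simpa [mul_assoc] using congrArg MulOpposite.unop (h (.op x))

lemma exists_linearMap_apply_eq_mul {A : Type} [Ring A] (hprime : IsPrimeRing A)
    [IsNoetherianRing Aᵐᵒᵖ] {C : Type} [AddCommGroup C] [Module Aᵐᵒᵖ C]
    {ι : Aᵐᵒᵖ →ₗ[Aᵐᵒᵖ] C} (hι : Function.Injective ι) {c : C}
    (hc : ∀ m, ∃ r s : Aᵐᵒᵖ, ι r + s • c = m) {a b : A} (ha : a ∈ nonZeroDivisors A)
    (hac : MulOpposite.op a • c = ι (.op b)) {x y : A} (hxy : y * a = x * b) :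
    ∃ φ : C →ₗ[Aᵐᵒᵖ] Aᵐᵒᵖ, ∀ r, φ (ι r) = r * .op x := by
  let π := ι.coprod (LinearMap.toSpanSingleton Aᵐᵒᵖ C c)
  let ψ := (LinearMap.toSpanSingleton Aᵐᵒᵖ Aᵐᵒᵖ (.op x)).coprod
    (LinearMap.toSpanSingleton Aᵐᵒᵖ Aᵐᵒᵖ (.op y))
  have hπ : Function.Surjective π := fun m ↦
    let ⟨r, s, h⟩ := hc m
    ⟨(r, s), by simpa [π] using h⟩
  have hle : LinearMap.ker π ≤ LinearMap.ker ψ := by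
    rintro ⟨r, s⟩ hrs
    replace hrs : ι r + s • c = 0 := by simpa [π] using hrs
    have hE : IsEssentialLeftIdeal (Ideal.span {MulOpposite.op a}) :=
      isEssentialLeftIdeal_span_singleton fun z hz ↦ by
        refine (MulOpposite.unop_eq_zero_iff z).1
          ((mem_nonZeroDivisors_iff.1 ha).1 _ ?_)
        simpa using congrArg MulOpposite.unop hz
    suffices r * .op x + s * .op y = 0 by simpa [ψ] using this
    refine hprime.mulOpposite.eq_zero_of_isEssentialLeftIdeal_ker
      ((hE.comap_mul_right s).mono fun t ht ↦ ?_)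
    obtain ⟨u, hu⟩ := Ideal.mem_span_singleton'.1
      (show t * s ∈ Ideal.span {MulOpposite.op a} from ht)
    have h0 : t * r + u * .op b = 0 := hι <| by
      have h := congrArg (t • ·) hrs
      simp only [smul_add, smul_smul, ← hu, smul_zero] at h
      rwa [mul_smul, hac, ← map_smul, ← map_smul, ← map_add, ← map_zero ι] at h
    have hxy' : MulOpposite.op a * .op y = .op b * .op x := by
      simp only [← MulOpposite.op_mul, hxy]
    suffices t * (r * .op x + s * .op y) = 0 by simpa using this
    rw [mul_add, ← mul_assoc, ← mul_assoc, ← hu, mul_assoc u, hxy', ← mul_assoc, ← add_mul, h0,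
      zero_mul]
  refine ⟨(LinearMap.ker π).liftQ ψ hle ∘ₗ (π.quotKerEquivOfSurjective hπ).symm, fun r ↦ ?_⟩
  have hr : (π.quotKerEquivOfSurjective hπ).symm (ι r) = (LinearMap.ker π).mkQ (r, 0) := by
    rw [LinearEquiv.symm_apply_eq]
    simp [π]
  simp [hr, ψ]

lemma exists_injective_to_free {A : Type} [Ring A] (hprime : IsPrimeRing A)
    [IsNoetherianRing Aᵐᵒᵖ] [IsNoetherianRing A] {C : Type} [AddCommGroup C] [Module Aᵐᵒᵖ C]
    {ι : Aᵐᵒᵖ →ₗ[Aᵐᵒᵖ] C} (hι : Function.Injective ι) (hCtf : RightTorsionFree A C)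
    (hCfr : ∀ c : C, ∃ a ∈ nonZeroDivisors A, MulOpposite.op a • c ∈ LinearMap.range ι)
    {c : C} (hc : ∀ m, ∃ r s : Aᵐᵒᵖ, ι r + s • c = m) :
    ∃ (G : Finset A) (φ : C →ₗ[Aᵐᵒᵖ] (G → Aᵐᵒᵖ)), Function.Injective φ := by
  obtain ⟨a, ha, b, hb⟩ := hCfr c
  obtain ⟨b, rfl⟩ := MulOpposite.op_surjective b
  let I : Ideal A := Submodule.comap (LinearMap.toSpanSingleton A A b) (Ideal.span {a})
  have hI : IsEssentialLeftIdeal I := (isEssentialLeftIdeal_span_singleton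
    (mem_nonZeroDivisors_iff.1 ha).2).comap_mul_right b
  obtain ⟨G, hG⟩ : I.FG := IsNoetherian.noetherian I
  have hφ : ∀ x : G, ∃ φ : C →ₗ[Aᵐᵒᵖ] Aᵐᵒᵖ, ∀ r, φ (ι r) = r * .op x.1 := fun x ↦ by
    have hx : x.1 ∈ I := hG ▸ Submodule.subset_span x.2
    obtain ⟨y, hy⟩ := Ideal.mem_span_singleton'.1 (show x.1 * b ∈ Ideal.span {a} from hx)
    exact exists_linearMap_apply_eq_mul hprime hι hc ha hb.symm hy
  choose φ hφ using hφ
  refine ⟨G, LinearMap.pi φ, (injective_iff_map_eq_zero _).2 fun m hm ↦ ?_⟩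
  have hm' : ∀ x, φ x m = 0 := fun x ↦ congrFun hm x
  obtain ⟨d, hd, r, hr⟩ := hCfr m
  have hr0 : r.unop = 0 := hprime.eq_zero_of_isEssentialLeftIdeal_ker <| hI.mono <| by
    rw [← hG, Submodule.span_le]
    intro x hx
    have h : r * .op x = 0 := by
      rw [← hφ ⟨x, hx⟩, hr, map_smul, hm', smul_zero]
    simpa using congrArg MulOpposite.unop h
  by_contra hm0
  refine hCtf m hm0 d hd ?_
  rw [← hr, (MulOpposite.unop_eq_zero_iff r).1 hr0, map_zero]

lemma Module.Projective.pi_const {R ι M : Type} [Ring R] [Fintype ι] [AddCommGroup M] [Module R M]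
    [Module.Projective R M] : Module.Projective R (ι → M) := by
  classical
  exact .of_equiv' (DFinsupp.linearEquivFunOnFintype (R := R) (M := fun _ : ι ↦ M))

/-- The linear equivalence `((v, q), (u, w)) ↦ (((v, u), w), q)`. -/
def prodRotateEquiv {R V Q U W : Type} [Ring R] [AddCommGroup V] [Module R V] [AddCommGroup Q]
    [Module R Q] [AddCommGroup U] [Module R U] [AddCommGroup W] [Module R W] :
    ((V × Q) × (U × W)) ≃ₗ[R] ((V × U) × W) × Q where
  toFun x := (((x.1.1, x.2.1), x.2.2), x.1.2)
  invFun x := ((x.1.1.1, x.2), (x.1.1.2, x.1.2))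
  left_inv _ := rfl
  right_inv _ := rfl
  map_add' _ _ := rfl
  map_smul' _ _ := rfl

/-- `K` is a kernel of a surjection from a finitely generated projective module onto `N`. -/
def IsSyzygy (R : Type) [Ring R] (N K : Type) [AddCommGroup N] [Module R N]
    [AddCommGroup K] [Module R K] : Prop :=
  ∃ (T : ModuleCat.{0} R) (j : K →ₗ[R] T) (g : T →ₗ[R] N), Module.Projective R T ∧
    Module.Finite R T ∧ Function.Injective j ∧ Function.Surjective g ∧ Function.Exact j g

namespace IsSyzygy

variable {R : Type} [Ring R] {N N' K K' Q : Type} [AddCommGroup N] [Module R N]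
  [AddCommGroup N'] [Module R N'] [AddCommGroup K] [Module R K] [AddCommGroup K'] [Module R K']
  [AddCommGroup Q] [Module R Q]

lemma congr_right (h : IsSyzygy R N K) (e : K' ≃ₗ[R] K) : IsSyzygy R N K' := by
  obtain ⟨T, j, g, hT, hT', hj, hg, hjg⟩ := h
  refine ⟨T, j ∘ₗ e, g, hT, hT', hj.comp e.injective, hg, fun t ↦ (hjg t).trans ?_⟩
  exact (e.surjective.range_comp j).symm ▸ Iff.rfl

lemma congr_left (h : IsSyzygy R N K) (e : N ≃ₗ[R] N') : IsSyzygy R N' K := by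
  obtain ⟨T, j, g, hT, hT', hj, hg, hjg⟩ := h
  exact ⟨T, j, e ∘ₗ g, hT, hT', hj, e.surjective.comp hg, fun t ↦ by simpa using hjg t⟩

lemma prod_right (h : IsSyzygy R N K) (Q : Type) [AddCommGroup Q] [Module R Q]
    [Module.Projective R Q] [Module.Finite R Q] : IsSyzygy R N (K × Q) := by
  obtain ⟨T, j, g, hT, hT', hj, hg, hjg⟩ := h
  refine ⟨.of R (T × Q), j.prodMap .id, g ∘ₗ .fst R T Q,
    inferInstanceAs (Module.Projective R (T × Q)), inferInstanceAs (Module.Finite R (T × Q)),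
    hj.prodMap Function.injective_id,
    hg.comp Prod.fst_surjective, ?_⟩
  rintro ⟨t, q⟩
  simpa [Prod.exists] using hjg t

lemma prod_left (h : IsSyzygy R N K) (Q : Type) [AddCommGroup Q] [Module R Q]
    [Module.Projective R Q] [Module.Finite R Q] : IsSyzygy R (N × Q) K := by
  obtain ⟨T, j, g, hT, hT', hj, hg, hjg⟩ := h
  refine ⟨.of R (T × Q), .inl R T Q ∘ₗ j, g.prodMap .id,
    inferInstanceAs (Module.Projective R (T × Q)),
    inferInstanceAs (Module.Finite R (T × Q)), LinearMap.inl_injective.comp hj,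
    hg.prodMap Function.surjective_id, ?_⟩
  rintro ⟨t, q⟩
  simp [hjg t, ← exists_and_right, eq_comm (a := q)]

lemma pi (h : IsSyzygy R N K) (s : ℕ) : IsSyzygy R (Fin s → N) (Fin s → K) := by
  obtain ⟨T, j, g, hT, hT', hj, hg, hjg⟩ := h
  refine ⟨.of R (Fin s → T), j.compLeft _, g.compLeft _,
    Module.Projective.pi_const,
    inferInstanceAs (Module.Finite R (Fin s → T)), hj.comp_left, hg.comp_left, fun t ↦ ?_⟩
  simp only [funext_iff, Set.mem_range, LinearMap.compLeft_apply, Function.comp_apply,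
    Pi.zero_apply]
  exact (forall_congr' fun i ↦ hjg (t i)).trans Classical.skolem

lemma of_exact (h : IsSyzygy R N K) [Module.Projective R Q] {i : Q →ₗ[R] N} {q : N →ₗ[R] N'}
    (hi : Function.Injective i) (hq : Function.Surjective q) (hiq : Function.Exact i q) :
    IsSyzygy R N' (K × Q) := by
  obtain ⟨T, j, g, hT, hT', hj, hg, hjg⟩ := h
  obtain ⟨l, hl⟩ := Module.projective_lifting_property g i hg
  have hl' : ∀ x, g (l x) = i x := fun x ↦ LinearMap.congr_fun hl x
  refine ⟨T, j.coprod l, q ∘ₗ g, hT, hT', ?_, hq.comp hg, fun t ↦ ⟨fun ht ↦ ?_, ?_⟩⟩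
  · rw [injective_iff_map_eq_zero]
    rintro ⟨x, y⟩ hxy
    replace hxy : j x + l y = 0 := by simpa using hxy
    have hy : y = 0 := hi <| by
      have := congrArg g hxy
      rwa [map_add, hjg.apply_apply_eq_zero, zero_add, hl', map_zero, ← map_zero i] at this
    subst hy
    rw [map_zero, add_zero] at hxy
    simp [(map_eq_zero_iff j hj).1 hxy]
  · obtain ⟨y, hy⟩ := (hiq (g t)).1 ht
    obtain ⟨x, hx⟩ := (hjg (t - l y)).1 (by rw [map_sub, hl', hy, sub_self])
    exact ⟨(x, y), by simp [hx]⟩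
  · rintro ⟨⟨x, y⟩, rfl⟩
    simp [hjg.apply_apply_eq_zero, hl', hiq.apply_apply_eq_zero]

/-- If a syzygy of `C ⧸ P` is `C ⊕ Q` with `P`, `Q` projective, then `C ⧸ P` has a self-extension
of finite projective dimension. -/
lemma exists_selfExtension {A : Type} [Ring A] {P Q C : Type} [AddCommGroup P] [Module Aᵐᵒᵖ P]
    [AddCommGroup Q] [Module Aᵐᵒᵖ Q] [AddCommGroup C] [Module Aᵐᵒᵖ C]
    [Module.Projective Aᵐᵒᵖ P] [Module.Projective Aᵐᵒᵖ Q]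
    {ι : P →ₗ[Aᵐᵒᵖ] C} (hι : Function.Injective ι)
    (h : IsSyzygy Aᵐᵒᵖ (C ⧸ LinearMap.range ι) (C × Q)) :
    ∃ (X : ModuleCat.{0} Aᵐᵒᵖ), Module.Finite Aᵐᵒᵖ X ∧ RightFinProjDim A X ∧
      ∃ (f : (C ⧸ LinearMap.range ι) →ₗ[Aᵐᵒᵖ] X)
        (g : X →ₗ[Aᵐᵒᵖ] (C ⧸ LinearMap.range ι)),
        Function.Injective f ∧ Function.Surjective g ∧ Function.Exact f g := by
  obtain ⟨T, j, g, hT, hT', hj, hg, hjg⟩ := h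
  let w : P × Q →ₗ[Aᵐᵒᵖ] T := j ∘ₗ ι.prodMap .id
  have hw : Function.Injective w := hj.comp (hι.prodMap Function.injective_id)
  have hgw : LinearMap.range w ≤ LinearMap.ker g := by
    rintro _ ⟨x, rfl⟩
    exact hjg.apply_apply_eq_zero _
  let u : C →ₗ[Aᵐᵒᵖ] T ⧸ LinearMap.range w := (LinearMap.range w).mkQ ∘ₗ j ∘ₗ .inl _ _ _
  have hu : LinearMap.ker u = LinearMap.range ι := by
    ext c
    suffices (∃ p q, j (ι p, q) = j (c, 0)) ↔ ∃ p, ι p = c by simpa [u, w] using this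
    simp [hj.eq_iff]
  refine ⟨.of _ (T ⧸ LinearMap.range w), inferInstanceAs (Module.Finite _ (T ⧸ LinearMap.range w)),
    rightFinProjDim_of_exact w _ hw (Submodule.mkQ_surjective _) (LinearMap.exact_map_mkQ_range w),
    (LinearMap.range ι).liftQ u hu.ge, (LinearMap.range w).liftQ g hgw, ?_, ?_, ?_⟩
  · rw [← LinearMap.ker_eq_bot, Submodule.ker_liftQ_eq_bot _ _ _ hu.le]
  · exact fun s ↦ let ⟨t, ht⟩ := hg s; ⟨(LinearMap.range w).mkQ t, ht⟩
  · intro x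
    obtain ⟨t, rfl⟩ := Submodule.mkQ_surjective _ x
    refine (hjg t).trans ⟨?_, ?_⟩
    · rintro ⟨⟨c, q⟩, rfl⟩
      refine ⟨Submodule.Quotient.mk c, ?_⟩
      refine (Submodule.Quotient.eq _).2 ⟨(0, -q), ?_⟩
      simp [w, ← map_sub]
    · rintro ⟨s, hs⟩
      obtain ⟨c, rfl⟩ := Submodule.mkQ_surjective _ s
      obtain ⟨p, hp⟩ := (Submodule.Quotient.eq _).1 hs
      refine ⟨(c, 0) - (ι.prodMap .id) p, ?_⟩
      rw [map_sub]
      exact sub_eq_of_eq_add' (sub_eq_iff_eq_add.1 hp.symm)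

end IsSyzygy

theorem stmt_4 (k A : Type) [Field k] [Ring A] [Algebra k A]
    (hprime : IsPrimeRing A)
    (hnoethR : IsNoetherianRing Aᵐᵒᵖ) (hnoethL : IsNoetherianRing A)
    (hinjR : RightSelfInjDimLE A 1) (hinjL : LeftSelfInjDimLE A 1)
    (hinjR' : ¬ RightSelfInjDimLE A 0)
    (hA : IsHereditaryRing A ∨ HasA1Singularity k A)
    -- `A ⊂ C ⊂ Fr(A)`:
    (C : Type) [AddCommGroup C] [Module Aᵐᵒᵖ C]
    (ι : Aᵐᵒᵖ →ₗ[Aᵐᵒᵖ] C) (hι : Function.Injective ι)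
    (hCtf : RightTorsionFree A C)
    (hCfr : ∀ c : C, ∃ a ∈ nonZeroDivisors A, (MulOpposite.op a) • c ∈ LinearMap.range ι)
    (hCne : LinearMap.range ι ≠ ⊤)
    -- `S = C/A` is simple:
    (hS : IsSimpleModule Aᵐᵒᵖ (C ⧸ LinearMap.range ι)) :
    RightFinProjDim A (C ⧸ LinearMap.range ι) ∨
    ∃ (X : ModuleCat.{0} Aᵐᵒᵖ), Module.Finite Aᵐᵒᵖ X ∧ RightFinProjDim A X ∧
      ∃ (f : (C ⧸ LinearMap.range ι) →ₗ[Aᵐᵒᵖ] X)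
        (g : X →ₗ[Aᵐᵒᵖ] (C ⧸ LinearMap.range ι)),
        Function.Injective f ∧ Function.Surjective g ∧ Function.Exact f g := by
  rcases hA with hA | ⟨M, hMfin, -, -, hgen, -, -, P₀, p, hP₀, hP₀', hp, P', Q', hP', hQ', hP'f,
    hQ'f, ⟨e₂⟩⟩
  · exact .inl ⟨1, fun N n hn ↦ hA _ _ n hn⟩
  right
  obtain ⟨c, hcι⟩ : ∃ c, c ∉ LinearMap.range ι := by
    by_contra! h
    exact hCne ((Submodule.eq_top_iff').2 h)
  have hc : ∀ m, ∃ r s : Aᵐᵒᵖ, ι r + s • c = m := fun m ↦ by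
    obtain ⟨s, hs⟩ := IsSimpleModule.toSpanSingleton_surjective Aᵐᵒᵖ
      (m := (LinearMap.range ι).mkQ c) (by simpa using hcι) ((LinearMap.range ι).mkQ m)
    obtain ⟨r, hr⟩ := (Submodule.Quotient.eq _).1 hs.symm
    exact ⟨r, s, by rw [hr]; exact sub_add_cancel _ _⟩
  have hCfin : Module.Finite Aᵐᵒᵖ C :=
    .of_surjective (ι.coprod (LinearMap.toSpanSingleton Aᵐᵒᵖ C c)) fun m ↦
      let ⟨r, s, h⟩ := hc m
      ⟨(r, s), by simpa using h⟩
  obtain ⟨G, φ, hφ⟩ := exists_injective_to_free hprime hι hCtf hCfr hc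
  obtain ⟨s, P, Q, hP, hQ, hPf, hQf, ⟨e₁⟩⟩ := hgen (.of _ C) hCfin (isMCM_of_injective hinjR φ hφ)
  have hQs : Module.Projective Aᵐᵒᵖ (Fin s → Q') := Module.Projective.pi_const
  have hM : IsSyzygy Aᵐᵒᵖ M (M × Q') :=
    IsSyzygy.congr_right (.prod_right ⟨P₀, _, p, hP₀, hP₀', Subtype.val_injective, hp,
      LinearMap.exact_subtype_ker_map p⟩ P') e₂.symm
  have hC : IsSyzygy Aᵐᵒᵖ (C × P) ((Fin s → M) × (Fin s → Q')) :=
    (((hM.pi s).congr_right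
      { Equiv.arrowProdEquivProdArrow (Fin s) (fun _ ↦ M) (fun _ ↦ Q') with
        map_add' _ _ := rfl
        map_smul' _ _ := rfl : (Fin s → M × Q') ≃ₗ[Aᵐᵒᵖ] _ }.symm).prod_left Q).congr_left e₁.symm
  have hq := (hC.of_exact (i := ι.prodMap (.id : P →ₗ[Aᵐᵒᵖ] P))
    (q := (LinearMap.range ι).mkQ ∘ₗ .fst Aᵐᵒᵖ C P) (hι.prodMap Function.injective_id)
    ((Submodule.mkQ_surjective _).comp Prod.fst_surjective)
    (by rintro ⟨x, y⟩; simp)).prod_right Q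
  exact IsSyzygy.exists_selfExtension hι (hq.congr_right
    ((LinearEquiv.prodAssoc _ _ _ _).symm ≪≫ₗ
      LinearEquiv.prodCongr e₁ (.refl _ _) ≪≫ₗ prodRotateEquiv))
end

section
/- Let A be a connected graded noetherian k-algebra of finite global dimension with Hilbert series (1−t)^{−n} for some n ≥ 2, and let d > 1. Then every linear module over the Veronese subring A^{(d)} (a cyclic graded module generated in degree 0 with Hilbert series (1−t)^{−p} for some p ≥ 1) is a point module, i.e. p = 1. -/
/-- `A` has global dimension at most `b` (on both sides). -/
def GlobalDimLE (A : Type) [Ring A] (b : ℕ) : Prop :=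
  (∀ (M N : ModuleCat A) (i : ℕ), b < i → Subsingleton (extGrp A i M N)) ∧
  (∀ (M N : ModuleCat Aᵐᵒᵖ) (i : ℕ), b < i → Subsingleton (extGrp Aᵐᵒᵖ i M N))

open CategoryTheory in
/-- For a surjection onto `M` from a projective module, the projective dimension of `M` is one more
than that of the kernel. -/
theorem hasProjectiveDimensionLT_iff_ker {R : Type} [Ring R] {P M : Type} [AddCommGroup P]
    [Module R P] [AddCommGroup M] [Module R M] [Module.Projective R P] (f : P →ₗ[R] M)
    (hf : Function.Surjective f) (n : ℕ) :
    HasProjectiveDimensionLT (ModuleCat.of R M) (n + 2) ↔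
      HasProjectiveDimensionLT (ModuleCat.of R (LinearMap.ker f)) (n + 1) :=
  (LinearMap.shortExact_shortComplexKer hf).hasProjectiveDimensionLT_X₃_iff n
    ((IsProjective.iff_projective P).1 inferInstance)

open CategoryTheory in
/-- If `Ext^(b+1)(M, N)` vanishes, every cocycle in degree `b + 1` of a projective resolution of `M`
with values in `N` is a coboundary. -/
theorem exists_extend_of_subsingleton_extGrp {R : Type} [Ring R] {M N : ModuleCat R} {b : ℕ}
    (h : Subsingleton (extGrp R (b + 1) M N)) (P : ProjectiveResolution M)
    (f : P.complex.X (b + 1) ⟶ N) (hf : P.complex.d (b + 2) (b + 1) ≫ f = 0) :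
    ∃ g : P.complex.X b ⟶ N, P.complex.d (b + 1) b ≫ g = f := by
  have h0 := (ModuleCat.isZero_of_subsingleton _).of_iso (P.isoExt (R := ℤ) (b + 1) N).symm
  rw [← HomologicalComplex.exactAt_iff_isZero_homology,
    HomologicalComplex.exactAt_iff' _ b (b + 1) (b + 2) (by simp) (by simp),
    ShortComplex.moduleCat_exact_iff] at h0
  exact h0 f hf

open CategoryTheory in
theorem exists_hasProjectiveDimensionLT {R : Type} [Ring R] (b : ℕ)
    (h : ∀ (M N : ModuleCat R) (i : ℕ), b < i → Subsingleton (extGrp R i M N))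
    (M : ModuleCat.{0} R) : HasProjectiveDimensionLT M (b + 2) := by
  let P := projectiveResolution M
  let d (n : ℕ) : P.complex.X (n + 1) →ₗ[R] P.complex.X n := (P.complex.d (n + 1) n).hom
  have hex (n : ℕ) : LinearMap.range (d (n + 1)) = LinearMap.ker (d n) :=
    (P.exact_succ n).moduleCat_range_eq_ker
  have hproj (n : ℕ) : Module.Projective R (P.complex.X n) := inferInstance
  have key (j : ℕ) : ∀ m, m + j = b →
      HasProjectiveDimensionLT (ModuleCat.of R (LinearMap.range (d m))) (j + 1) := by
    induction j with
    | zero =>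
      rintro m rfl
      obtain ⟨g, hg⟩ := exists_extend_of_subsingleton_extGrp
        (h M (ModuleCat.of R (LinearMap.range (d m))) (m + 1) (by simp)) P
        (ModuleCat.ofHom (d m).rangeRestrict) (by
          ext x
          have : d (m + 1) x ∈ LinearMap.ker (d m) := hex m ▸ LinearMap.mem_range_self _ x
          exact this)
      have : Module.Projective R (LinearMap.range (d m)) := by
        refine Module.Projective.of_split (LinearMap.range (d m)).subtype g.hom ?_
        ext ⟨_, x, rfl⟩
        exact congrArg Subtype.val (ConcreteCategory.congr_hom hg x)
      exact projective_iff_hasProjectiveDimensionLT_one.1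
        ((IsProjective.iff_projective _).1 this)
    | succ j ih =>
      rintro m hm
      rw [hasProjectiveDimensionLT_iff_ker _ (d m).surjective_rangeRestrict,
        LinearMap.ker_rangeRestrict, ← hex]
      exact ih _ (by omega)
  have hπ : Function.Surjective (P.π.f 0).hom :=
    (ModuleCat.epi_iff_surjective _).1 inferInstance
  refine (hasProjectiveDimensionLT_iff_ker (P.π.f 0).hom hπ b).2 ?_
  rw [← show LinearMap.range (d 0) = _ from P.exact₀.moduleCat_range_eq_ker]
  exact key b 0 (by simp)

/-- The function `h` agrees with a polynomial at all large natural numbers. -/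
def EventuallyPoly (h : ℕ → ℚ) : Prop :=
  ∃ q : Polynomial ℚ, ∃ N : ℕ, ∀ j, N ≤ j → h j = q.eval (j : ℚ)

namespace EventuallyPoly

theorem zero : EventuallyPoly (fun _ => 0) := ⟨0, 0, by simp⟩

theorem add {f g : ℕ → ℚ} (hf : EventuallyPoly f) (hg : EventuallyPoly g) :
    EventuallyPoly (fun j => f j + g j) := by
  obtain ⟨p, N, hp⟩ := hf
  obtain ⟨q, N', hq⟩ := hg
  refine ⟨p + q, max N N', fun j hj => ?_⟩
  beta_reduce
  rw [hp j (le_of_max_le_left hj), hq j (le_of_max_le_right hj), Polynomial.eval_add]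

theorem sub {f g : ℕ → ℚ} (hf : EventuallyPoly f) (hg : EventuallyPoly g) :
    EventuallyPoly (fun j => f j - g j) := by
  obtain ⟨p, N, hp⟩ := hf
  obtain ⟨q, N', hq⟩ := hg
  refine ⟨p - q, max N N', fun j hj => ?_⟩
  beta_reduce
  rw [hp j (le_of_max_le_left hj), hq j (le_of_max_le_right hj), Polynomial.eval_sub]

theorem sum {ι : Type*} (s : Finset ι) {f : ι → ℕ → ℚ} (hf : ∀ i ∈ s, EventuallyPoly (f i)) :
    EventuallyPoly (fun j => ∑ i ∈ s, f i j) := by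
  classical
  induction s using Finset.induction_on with
  | empty => simpa using zero
  | insert a s ha ih =>
    simp only [Finset.sum_insert ha]
    exact (hf a (by simp)).add (ih fun i hi => hf i (by simp [hi]))

theorem shift {f : ℕ → ℚ} (hf : EventuallyPoly f) (e : ℕ) :
    EventuallyPoly (fun j => if e ≤ j then f (j - e) else 0) := by
  obtain ⟨q, N, hq⟩ := hf
  refine ⟨q.comp (Polynomial.X - Polynomial.C (e : ℚ)), N + e, fun j hj => ?_⟩
  have he : e ≤ j := by omega
  simp [he, hq (j - e) (by omega), Nat.cast_sub he]

end EventuallyPoly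

/-- The polynomial taking the value `(j + N).choose N` at each natural number `j`. -/
noncomputable def choosePoly (N : ℕ) : Polynomial ℚ :=
  Polynomial.C ((N.factorial : ℚ)⁻¹) * ∏ i ∈ Finset.range N, (Polynomial.X + Polynomial.C (1 + i : ℚ))

theorem choosePoly_eval (N : ℕ) (x : ℚ) :
    N.factorial * (choosePoly N).eval x = ∏ i ∈ Finset.range N, (x + (1 + i)) := by
  have : (N.factorial : ℚ) ≠ 0 := by exact_mod_cast N.factorial_ne_zero
  simp [choosePoly, Polynomial.eval_prod, this]

theorem choosePoly_eval_natCast (N j : ℕ) :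
    (choosePoly N).eval (j : ℚ) = ((j + N).choose N : ℚ) := by
  have h0 : (N.factorial : ℚ) ≠ 0 := by exact_mod_cast N.factorial_ne_zero
  apply mul_left_cancel₀ h0
  rw [choosePoly_eval]
  have := Nat.ascFactorial_eq_factorial_mul_choose j N
  rw [Nat.ascFactorial_eq_prod_range] at this
  rw [← Nat.cast_mul, ← this]
  push_cast
  exact Finset.prod_congr rfl fun i _ => by ring

theorem eventuallyPoly_choose (n : ℕ) (hn : 1 ≤ n) :
    EventuallyPoly (fun j => ((j + n - 1).choose (n - 1) : ℚ)) :=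
  ⟨choosePoly (n - 1), 0, fun j _ => by simp [choosePoly_eval_natCast, Nat.add_sub_assoc hn]⟩

/-- An integer-valued, eventually polynomial function cannot have values `(m + p - 1).choose (p - 1)`
at the multiples `d * m` of some `d > 1`, unless `p = 1`. -/
theorem eq_one_of_eventuallyPoly {d p : ℕ} (hd : 1 < d) (hp : 1 ≤ p) (h : ℕ → ℤ)
    (hpoly : EventuallyPoly (fun j => (h j : ℚ)))
    (hval : ∀ m, h (d * m) = ((m + p - 1).choose (p - 1) : ℕ)) : p = 1 := by
  obtain ⟨N, rfl⟩ : ∃ N, p = N + 1 := ⟨p - 1, by omega⟩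
  obtain ⟨q, J, hq⟩ := hpoly
  have hd0 : (d : ℚ) ≠ 0 := by positivity
  have hcomp : q.comp (Polynomial.C (d : ℚ) * Polynomial.X) = choosePoly N := by
    apply Polynomial.eq_of_infinite_eval_eq
    refine Set.Infinite.mono (s := Set.range fun m : ℕ => ((J + m : ℕ) : ℚ)) ?_
      (Set.infinite_range_of_injective fun a b hab => by simpa using hab)
    rintro _ ⟨m, rfl⟩
    have h1 := hq (d * (J + m)) (by nlinarith)
    beta_reduce at h1
    rw [hval] at h1
    simp only [Set.mem_ofPred_eq, choosePoly_eval_natCast, Polynomial.eval_comp,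
      Polynomial.eval_mul, Polynomial.eval_C, Polynomial.eval_X]
    rw [← Nat.cast_mul, ← h1]
    simp [← Nat.add_assoc]
  have hlin (x : ℚ) : q.eval x = (choosePoly N).eval (x / d) := by
    rw [← hcomp]
    simp [mul_div_cancel₀ _ hd0]
  have hprod : ((N.factorial * d ^ N * h (d * J + 1) : ℤ)) =
      ∏ i ∈ Finset.range N, ((d * J + 1 : ℤ) + d * (1 + i)) := by
    have h1 := hq (d * J + 1) (by nlinarith)
    rw [hlin] at h1
    have h2 := choosePoly_eval N (((d * J + 1 : ℕ) : ℚ) / d)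
    rw [← h1] at h2
    have h3 : (N.factorial * d ^ N * h (d * J + 1) : ℚ) =
      ∏ i ∈ Finset.range N, ((d * J + 1 : ℚ) + d * (1 + i)) := by
      rw [mul_right_comm, h2, ← Finset.card_range N, ← Finset.prod_const, Finset.card_range,
        ← Finset.prod_mul_distrib]
      refine Finset.prod_congr rfl fun i _ => ?_
      push_cast
      field_simp
    exact_mod_cast h3
  by_contra hN
  have hmod : (∏ i ∈ Finset.range N, ((d * J + 1 : ℤ) + d * (1 + i))) ≡ 1 [ZMOD d] := by
    have : ∀ i ∈ Finset.range N, ((d * J + 1 : ℤ) + d * (1 + i)) ≡ 1 [ZMOD d] := fun i _ =>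
      (Int.modEq_iff_dvd.2 ⟨-(J + 1 + i), by ring⟩)
    simpa using Int.ModEq.prod this
  rw [← hprod] at hmod
  have h1 : (d : ℤ) ∣ 1 :=
    (Int.ModEq.dvd_iff hmod).1
      (((dvd_pow_self _ (by omega)).mul_left _).mul_right _)
  have := Int.le_of_dvd one_pos h1
  omega

/-- An `ℕ`-grading of a vector space, given by the projections onto its components. -/
structure VecGrading (k M : Type) [Field k] [AddCommGroup M] [Module k M] where
  /-- The projection onto the component of degree `j`. -/
  proj : ℕ → M →ₗ[k] M
  proj_proj : ∀ i j x, proj i (proj j x) = if i = j then proj j x else 0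
  exists_sum_eq : ∀ x, ∃ N, ∀ n, N ≤ n → ∑ i ∈ Finset.range n, proj i x = x

namespace VecGrading

variable {k M F : Type} [Field k] [AddCommGroup M] [Module k M] [AddCommGroup F] [Module k F]

/-- The Hilbert function. -/
noncomputable def hilb (π : VecGrading k M) (j : ℕ) : ℕ :=
  Module.finrank k (LinearMap.range (π.proj j))

theorem mem_range_iff (π : VecGrading k M) {j : ℕ} {x : M} :
    x ∈ LinearMap.range (π.proj j) ↔ π.proj j x = x :=
  ⟨by rintro ⟨y, rfl⟩; simp [π.proj_proj], fun h => ⟨x, h⟩⟩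

theorem proj_of_mem (π : VecGrading k M) {j : ℕ} {x : M} (hx : π.proj j x = x) (i : ℕ) :
    π.proj i x = if i = j then x else 0 := by
  rw [← hx, π.proj_proj]

theorem ext_proj (π : VecGrading k M) {x y : M} (h : ∀ j, π.proj j x = π.proj j y) : x = y := by
  obtain ⟨N, hN⟩ := π.exists_sum_eq x
  obtain ⟨N', hN'⟩ := π.exists_sum_eq y
  rw [← hN (max N N') (le_max_left _ _), ← hN' (max N N') (le_max_right _ _)]
  exact Finset.sum_congr rfl fun i _ => h i

/-- The grading attached to an internal direct sum decomposition. -/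
noncomputable def ofDecomposition (ℳ : ℕ → Submodule k M) [DirectSum.Decomposition ℳ] :
    VecGrading k M where
  proj j := (ℳ j).subtype ∘ₗ DirectSum.component k ℕ (fun i => ℳ i) j ∘ₗ
    (DirectSum.decomposeLinearEquiv ℳ).toLinearMap
  proj_proj i j x := by
    change ((DirectSum.decompose ℳ ((DirectSum.decompose ℳ x j : ℳ j) : M)) i : M) =
      if i = j then ((DirectSum.decompose ℳ x j : ℳ j) : M) else 0
    split_ifs with h
    · subst h; simp
    · rw [DirectSum.decompose_of_mem_ne ℳ (SetLike.coe_mem _) (Ne.symm h)]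
  exists_sum_eq x := by
    classical
    refine ⟨(DirectSum.decompose ℳ x).support.sup id + 1, fun n hn => ?_⟩
    change ∑ i ∈ Finset.range n, ((DirectSum.decompose ℳ x i : ℳ i) : M) = x
    conv_rhs => rw [← DirectSum.sum_support_decompose ℳ x]
    symm
    refine Finset.sum_subset (fun i hi => ?_) fun i _ hi => ?_
    · have := Finset.le_sup (f := id) hi
      simp only [id, Finset.mem_range] at *
      omega
    · simpa using hi

theorem ofDecomposition_proj_apply (ℳ : ℕ → Submodule k M) [DirectSum.Decomposition ℳ] (j : ℕ)
    (x : M) : (ofDecomposition ℳ).proj j x = DirectSum.decompose ℳ x j := rfl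

theorem ofDecomposition_proj_eq_self_iff (ℳ : ℕ → Submodule k M) [DirectSum.Decomposition ℳ]
    (j : ℕ) (x : M) : (ofDecomposition ℳ).proj j x = x ↔ x ∈ ℳ j := by
  rw [ofDecomposition_proj_apply]
  exact ⟨fun h => h ▸ SetLike.coe_mem _, fun h => DirectSum.decompose_of_mem_same ℳ h⟩

theorem range_ofDecomposition_proj (ℳ : ℕ → Submodule k M) [DirectSum.Decomposition ℳ] (j : ℕ) :
    LinearMap.range ((ofDecomposition ℳ).proj j) = ℳ j := by
  ext x
  rw [mem_range_iff, ofDecomposition_proj_eq_self_iff]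

/-- Transport of a grading along a linear equivalence. -/
def congr (π : VecGrading k M) (e : M ≃ₗ[k] F) : VecGrading k F where
  proj j := e.toLinearMap ∘ₗ π.proj j ∘ₗ e.symm.toLinearMap
  proj_proj i j x := by
    simp only [LinearMap.comp_apply, LinearEquiv.coe_coe, LinearEquiv.symm_apply_apply, π.proj_proj]
    split_ifs <;> simp
  exists_sum_eq x := by
    obtain ⟨N, hN⟩ := π.exists_sum_eq (e.symm x)
    refine ⟨N, fun n hn => ?_⟩
    simp only [LinearMap.comp_apply, LinearEquiv.coe_coe]
    rw [← map_sum, hN n hn, e.apply_symm_apply]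

theorem hilb_congr (π : VecGrading k M) (e : M ≃ₗ[k] F) (j : ℕ) :
    (π.congr e).hilb j = π.hilb j := by
  have : LinearMap.range ((π.congr e).proj j) = (LinearMap.range (π.proj j)).map e.toLinearMap := by
    change LinearMap.range (e.toLinearMap ∘ₗ π.proj j ∘ₗ e.symm.toLinearMap) = _
    rw [LinearMap.range_comp, LinearMap.range_comp_of_range_eq_top _ e.symm.range]
  rw [hilb, this]
  exact LinearEquiv.finrank_map_eq e _

end VecGrading

theorem finrank_map_add_finrank_inf_ker {k V W : Type} [Field k] [AddCommGroup V] [Module k V]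
    [AddCommGroup W] [Module k W] (p : Submodule k V) [FiniteDimensional k p] (f : V →ₗ[k] W) :
    Module.finrank k (p.map f) + Module.finrank k (p ⊓ LinearMap.ker f : Submodule k V) =
      Module.finrank k p := by
  rw [← LinearMap.finrank_range_add_finrank_ker (f.domRestrict p), LinearMap.range_domRestrict,
    LinearMap.ker_domRestrict, ← Submodule.map_comap_subtype]
  congr 1
  exact (Submodule.equivMapOfInjective p.subtype p.injective_subtype _).finrank_eq.symm

/-- Compatibility of the gradings of a ring and of a module over it: `R_i • M_j ⊆ M_(i+j)`. -/
def GradedSMulCompat {k R M : Type} [Field k] [Ring R] [Algebra k R] [AddCommGroup M] [Module k M]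
    [Module R M] (ρ : VecGrading k R) (π : VecGrading k M) : Prop :=
  ∀ i j a x, π.proj (i + j) (ρ.proj i a • π.proj j x) = ρ.proj i a • π.proj j x

namespace GradedSMulCompat

variable {k R M : Type} [Field k] [Ring R] [Algebra k R] [AddCommGroup M] [Module k M]
    [Module R M] {ρ : VecGrading k R} {π : VecGrading k M}

theorem proj_smul (h : GradedSMulCompat ρ π) (a : R) {x : M} {e : ℕ} (hx : π.proj e x = x)
    (j : ℕ) : π.proj j (a • x) = if e ≤ j then ρ.proj (j - e) a • x else 0 := by
  obtain ⟨N, hN⟩ := ρ.exists_sum_eq a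
  have hterm (i : ℕ) : π.proj j (ρ.proj i a • x) = if j = i + e then ρ.proj i a • x else 0 :=
    π.proj_of_mem (by simpa [hx] using h i e a x) j
  conv_lhs => rw [← hN (max N (j + 1)) (le_max_left _ _), Finset.sum_smul, map_sum]
  simp only [hterm]
  split_ifs with he
  · rw [Finset.sum_eq_single (j - e)]
    · rw [if_pos (by omega)]
    · intro b _ hb
      rw [if_neg (by omega)]
    · intro hj
      simp only [Finset.mem_range] at hj
      omega
  · exact Finset.sum_eq_zero fun i _ => if_neg (by omega)

theorem proj_smul_eq_zero (h : GradedSMulCompat ρ π) {a : R} (ha : ρ.proj 0 a = 0) {y : M} {j : ℕ}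
    (hy : ∀ l, l < j → π.proj l y = 0) : π.proj j (a • y) = 0 := by
  obtain ⟨N, hN⟩ := π.exists_sum_eq y
  rw [← hN N le_rfl, Finset.smul_sum, map_sum]
  refine Finset.sum_eq_zero fun q _ => ?_
  rw [h.proj_smul a (e := q) (by simp [π.proj_proj]) j]
  split_ifs with hq
  · obtain rfl | hlt := hq.eq_or_lt
    · simp [ha]
    · simp [hy q hlt]
  · rfl

end GradedSMulCompat

namespace VecGrading

section Free

variable {k R : Type} [Field k] [Ring R] [Algebra k R]

/-- The graded free module with basis elements in degrees `e i`. -/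
noncomputable def free (ρ : VecGrading k R) {r : ℕ} (e : Fin r → ℕ) :
    VecGrading k (Fin r → R) where
  proj j := LinearMap.pi fun i =>
    if e i ≤ j then ρ.proj (j - e i) ∘ₗ LinearMap.proj i else 0
  proj_proj i j x := by
    ext l
    rw [LinearMap.pi_apply]
    by_cases hi : e l ≤ i
    · by_cases hj : e l ≤ j
      · simp only [hi, if_true, LinearMap.comp_apply, LinearMap.proj_apply, LinearMap.pi_apply, hj,
          ρ.proj_proj]
        by_cases hij : i = j
        · simp [hij, hj]
        · rw [if_neg (by omega), if_neg hij]; rfl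
      · rw [if_neg (show i ≠ j by omega)]
        simp [hi, hj]
    · by_cases hij : i = j
      · subst hij; simp [hi]
      · simp [hi, hij]
  exists_sum_eq x := by
    choose N hN using fun i => ρ.exists_sum_eq (x i)
    refine ⟨∑ i, (N i + e i), fun n hn => ?_⟩
    ext l
    have hl : N l + e l ≤ n :=
      (Finset.single_le_sum (f := fun i => N i + e i) (fun _ _ => Nat.zero_le _)
        (Finset.mem_univ l)).trans hn
    rw [Finset.sum_apply]
    simp only [LinearMap.pi_apply]
    obtain ⟨m, rfl⟩ : ∃ m, n = e l + m := ⟨n - e l, by omega⟩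
    rw [Finset.sum_range_add, Finset.sum_eq_zero (fun i hi => ?_), zero_add]
    · simp only [Nat.le_add_right, if_true, Nat.add_sub_cancel_left, LinearMap.comp_apply,
        LinearMap.proj_apply]
      exact hN l m (by omega)
    · simp only [Finset.mem_range] at hi
      simp [Nat.not_le.2 hi]

theorem free_proj_apply (ρ : VecGrading k R) {r : ℕ} (e : Fin r → ℕ) (j : ℕ) (f : Fin r → R)
    (i : Fin r) :
    (ρ.free e).proj j f i = if e i ≤ j then ρ.proj (j - e i) (f i) else 0 := by
  change (if e i ≤ j then ρ.proj (j - e i) ∘ₗ LinearMap.proj i else 0 : (Fin r → R) →ₗ[k] R) f = _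
  split_ifs <;> rfl

theorem free_compat {ρ : VecGrading k R} (h : GradedSMulCompat ρ ρ) {r : ℕ} (e : Fin r → ℕ) :
    GradedSMulCompat ρ (ρ.free e) := by
  intro i j a x
  ext l
  simp only [free_proj_apply, Pi.smul_apply, smul_eq_mul]
  by_cases hj : e l ≤ j
  · have := h i (j - e l) a (x l)
    simp only [hj, if_true, show e l ≤ i + j by omega, Nat.add_sub_assoc hj]
    exact this
  · simp [hj]

/-- The homogeneous components of a graded free module. -/
noncomputable def freeRangeEquiv (ρ : VecGrading k R) {r : ℕ} (e : Fin r → ℕ) (j : ℕ) :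
    LinearMap.range ((ρ.free e).proj j) ≃ₗ[k]
      ((i : Fin r) → (if e i ≤ j then LinearMap.range (ρ.proj (j - e i)) else ⊥ : Submodule k R))
    where
  toFun f i := ⟨f.1 i, by
    rw [← (ρ.free e).mem_range_iff.1 f.2, free_proj_apply]
    split_ifs
    · exact LinearMap.mem_range_self _ _
    · exact Submodule.zero_mem _⟩
  map_add' _ _ := rfl
  map_smul' _ _ := rfl
  invFun g := ⟨fun i => (g i).1, by
    rw [mem_range_iff]
    ext i
    rw [free_proj_apply]
    have hmem (x : R)
        (hx : x ∈ (if e i ≤ j then LinearMap.range (ρ.proj (j - e i)) else ⊥ : Submodule k R)) :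
        (if e i ≤ j then ρ.proj (j - e i) x else 0) = x := by
      split_ifs at hx ⊢ with h
      · exact (mem_range_iff _).1 hx
      · exact ((Submodule.mem_bot k).1 hx).symm
    exact hmem _ (g i).2⟩
  left_inv _ := rfl
  right_inv _ := rfl

variable {ρ : VecGrading k R}

theorem finiteDimensional_free (hfin : ∀ j, FiniteDimensional k (LinearMap.range (ρ.proj j)))
    {r : ℕ} (e : Fin r → ℕ) (j : ℕ) :
    FiniteDimensional k (LinearMap.range ((ρ.free e).proj j)) := by
  have (i : Fin r) : FiniteDimensional k
      (if e i ≤ j then LinearMap.range (ρ.proj (j - e i)) else ⊥ : Submodule k R) := by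
    by_cases h : e i ≤ j
    · rw [if_pos h]; infer_instance
    · rw [if_neg h]; infer_instance
  exact (ρ.freeRangeEquiv e j).symm.finiteDimensional

theorem hilb_free (hfin : ∀ j, FiniteDimensional k (LinearMap.range (ρ.proj j)))
    {r : ℕ} (e : Fin r → ℕ) (j : ℕ) :
    (ρ.free e).hilb j = ∑ i, if e i ≤ j then ρ.hilb (j - e i) else 0 := by
  have (i : Fin r) : FiniteDimensional k
      (if e i ≤ j then LinearMap.range (ρ.proj (j - e i)) else ⊥ : Submodule k R) := by
    by_cases h : e i ≤ j
    · rw [if_pos h]; infer_instance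
    · rw [if_neg h]; infer_instance
  rw [hilb, (ρ.freeRangeEquiv e j).finrank_eq, Module.finrank_pi_fintype]
  refine Finset.sum_congr rfl fun i _ => ?_
  by_cases h : e i ≤ j
  · rw [if_pos h, if_pos h, hilb]
  · rw [if_neg h, if_neg h, finrank_bot]

end Free

section Restrict

variable {k R M : Type} [Field k] [Ring R] [Algebra k R] [AddCommGroup M] [Module k M]
    [Module R M] [IsScalarTower k R M]

/-- The grading of a graded submodule. -/
def restrict (π : VecGrading k M) (K : Submodule R M) (hK : ∀ j, ∀ x ∈ K, π.proj j x ∈ K) :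
    VecGrading k K where
  proj j :=
    { toFun x := ⟨π.proj j x, hK j x x.2⟩
      map_add' x y := Subtype.ext (map_add _ _ _)
      map_smul' c x := Subtype.ext (map_smul _ _ _) }
  proj_proj i j x := by
    apply Subtype.ext
    change π.proj i (π.proj j x) = _
    rw [π.proj_proj]
    split_ifs <;> rfl
  exists_sum_eq x := by
    obtain ⟨N, hN⟩ := π.exists_sum_eq x
    exact ⟨N, fun n hn => Subtype.ext ((map_sum K.subtype _ _).trans (hN n hn))⟩

theorem restrict_compat {ρ : VecGrading k R} {π : VecGrading k M} (h : GradedSMulCompat ρ π)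
    {K : Submodule R M} (hK : ∀ j, ∀ x ∈ K, π.proj j x ∈ K) :
    GradedSMulCompat ρ (π.restrict K hK) :=
  fun i j a x => Subtype.ext (h i j a x)

theorem hilb_restrict (π : VecGrading k M) {K : Submodule R M}
    (hK : ∀ j, ∀ x ∈ K, π.proj j x ∈ K) (j : ℕ) :
    (π.restrict K hK).hilb j =
      Module.finrank k (LinearMap.range (π.proj j) ⊓ K.restrictScalars k : Submodule k M) := by
  have : (LinearMap.range ((π.restrict K hK).proj j)).map (K.subtype.restrictScalars k) =
      LinearMap.range (π.proj j) ⊓ K.restrictScalars k := by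
    ext x
    simp only [Submodule.mem_map, Submodule.mem_inf, mem_range_iff, Submodule.restrictScalars_mem]
    constructor
    · rintro ⟨y, hy, rfl⟩
      exact ⟨congrArg Subtype.val hy, y.2⟩
    · rintro ⟨hx, hxK⟩
      exact ⟨⟨x, hxK⟩, Subtype.ext hx, rfl⟩
  rw [← this]
  exact (Submodule.equivMapOfInjective (K.subtype.restrictScalars k) K.subtype_injective _).finrank_eq

end Restrict

end VecGrading

/-- A minimal graded free cover of a projective module is an isomorphism. -/
theorem ker_eq_bot_of_projective {k R M : Type} [Field k] [Ring R] [Algebra k R] [AddCommGroup M]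
    [Module R M] [Module.Projective R M] {ρ : VecGrading k R} (hρ : GradedSMulCompat ρ ρ) {r : ℕ}
    (e : Fin r → ℕ) (φ : (Fin r → R) →ₗ[R] M) (hφ : Function.Surjective φ)
    (hker : ∀ f ∈ LinearMap.ker φ, ∀ i, ρ.proj 0 (f i) = 0) : LinearMap.ker φ = ⊥ := by
  classical
  obtain ⟨s, hs⟩ := Module.projective_lifting_property φ LinearMap.id hφ
  have hs' (m : M) : φ (s m) = m := LinearMap.congr_fun hs m
  let P : (Fin r → R) →ₗ[R] (Fin r → R) := LinearMap.id - s ∘ₗ φ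
  have hPmem (f : Fin r → R) : P f ∈ LinearMap.ker φ := by simp [P, hs']
  have hPker (f : Fin r → R) (hf : f ∈ LinearMap.ker φ) : P f = f := by
    simp [P, LinearMap.mem_ker.1 hf]
  have hzero (j : ℕ) : ∀ f ∈ LinearMap.ker φ, (ρ.free e).proj j f = 0 := by
    induction j using Nat.strong_induction_on with
    | _ j ih =>
      intro f hf
      have hsum : f = ∑ i, f i • P (Pi.single i 1) := by
        conv_lhs => rw [← hPker f hf, pi_eq_sum_univ' f]
        simp [map_sum]
      rw [hsum, map_sum]
      exact Finset.sum_eq_zero fun i _ => (VecGrading.free_compat hρ e).proj_smul_eq_zero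
        (hker f hf i) fun l hl => ih l hl _ (hPmem _)
  rw [eq_bot_iff]
  intro f hf
  exact (ρ.free e).ext_proj fun j => by rw [hzero j f hf, map_zero]

section Resolution

variable {k R M : Type} [Field k] [Ring R] [Algebra k R] [AddCommGroup M] [Module k M]
    [Module R M] {ρ : VecGrading k R} {π : VecGrading k M}

theorem VecGrading.exists_homogeneous_generators (R : Type) [Ring R] [Module R M]
    [Module.Finite R M] (π : VecGrading k M) :
    ∃ (r : ℕ) (e : Fin r → ℕ) (x : Fin r → M), (∀ i, π.proj (e i) (x i) = x i) ∧
      Submodule.span R (Set.range x) = ⊤ := by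
  classical
  obtain ⟨S, hS⟩ := Module.Finite.fg_top (R := R) (M := M)
  choose N hN using π.exists_sum_eq
  let T : Finset M := S.biUnion fun s => (Finset.range (N s)).image fun i => π.proj i s
  have hT (t : T) : ∃ e, π.proj e (t : M) = t := by
    obtain ⟨t, ht⟩ := t
    simp only [T, Finset.mem_biUnion, Finset.mem_image] at ht
    obtain ⟨s, -, i, -, rfl⟩ := ht
    exact ⟨i, by simp [π.proj_proj]⟩
  choose e he using hT
  refine ⟨T.card, fun i => e (T.equivFin.symm i), fun i => T.equivFin.symm i, fun i => he _, ?_⟩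
  have hrange : Set.range (fun i => ((T.equivFin.symm i : T) : M)) = T := by
    rw [← Function.comp_def Subtype.val, Set.range_comp, T.equivFin.symm.range_eq_univ,
      Set.image_univ, Subtype.range_coe]
  rw [hrange, eq_top_iff, ← hS, Submodule.span_le]
  intro s hs
  rw [← hN s _ le_rfl]
  refine Submodule.sum_mem _ fun i hi => Submodule.subset_span ?_
  simp only [T, Finset.mem_coe, Finset.mem_biUnion, Finset.mem_image]
  exact ⟨s, hs, i, hi, rfl⟩

/-- Over a connected graded algebra, a finitely generated graded module has a graded free cover whose
kernel is contained in `R_+ F`. -/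
theorem exists_minimal_cover [IsScalarTower k R M] [Module.Finite R M]
    (h : GradedSMulCompat ρ π) (h0 : ∀ a, ∃ c, ρ.proj 0 a = algebraMap k R c) :
    ∃ (r : ℕ) (e : Fin r → ℕ) (φ : (Fin r → R) →ₗ[R] M), Function.Surjective φ ∧
      (∀ j f, π.proj j (φ f) = φ ((ρ.free e).proj j f)) ∧
      ∀ f ∈ LinearMap.ker φ, ∀ i, ρ.proj 0 (f i) = 0 := by
  classical
  have hex := π.exists_homogeneous_generators R
  obtain ⟨e, x, hx, hspan⟩ := Nat.find_spec hex
  have hmin := fun m => Nat.find_min hex (m := m)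
  generalize Nat.find hex = r at e x hx hspan hmin
  have hcomm (j : ℕ) (f : Fin r → R) : π.proj j (Fintype.linearCombination R x f) =
      Fintype.linearCombination R x ((ρ.free e).proj j f) := by
    simp only [Fintype.linearCombination_apply, map_sum, h.proj_smul _ (hx _),
      VecGrading.free_proj_apply, ite_smul, zero_smul]
  refine ⟨r, e, Fintype.linearCombination R x, ?_, hcomm, ?_⟩
  · rw [← LinearMap.range_eq_top, Fintype.range_linearCombination, hspan]
  · intro f hf i
    by_contra hne
    obtain ⟨c, hc⟩ := h0 (f i)
    have hc0 : c ≠ 0 := by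
      rintro rfl
      exact hne (by rw [hc, map_zero])
    have hg := hcomm (e i) f
    rw [LinearMap.mem_ker.1 hf, map_zero] at hg
    set g := (ρ.free e).proj (e i) f with hgdef
    have hgi : g i = algebraMap k R c := by
      rw [hgdef, VecGrading.free_proj_apply]
      simpa using hc
    obtain ⟨r, rfl⟩ : ∃ m, r = m + 1 := ⟨r - 1, by have := i.2; omega⟩
    refine hmin r (Nat.lt_succ_self r) ⟨e ∘ i.succAbove, x ∘ i.succAbove, fun l => hx _, ?_⟩
    have hxi : x i ∈ Submodule.span R (Set.range (x ∘ i.succAbove)) := by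
      rw [Fintype.linearCombination_apply, Fin.sum_univ_succAbove _ i, hgi, algebraMap_smul] at hg
      have hsum : ∑ l, g (i.succAbove l) • x (i.succAbove l) ∈
          Submodule.span R (Set.range (x ∘ i.succAbove)) :=
        Submodule.sum_mem _ fun l _ =>
          Submodule.smul_mem _ _ (Submodule.subset_span (Set.mem_range_self l))
      have : x i = (-c⁻¹) • ∑ l, g (i.succAbove l) • x (i.succAbove l) := by
        rw [neg_smul, ← smul_neg, ← eq_neg_of_add_eq_zero_left hg.symm, smul_smul,
          inv_mul_cancel₀ hc0, one_smul]
      rw [this, ← algebraMap_smul R (-c⁻¹)]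
      exact Submodule.smul_mem _ _ hsum
    rw [eq_top_iff, ← hspan, Submodule.span_le]
    rintro _ ⟨l, rfl⟩
    obtain rfl | ⟨l, rfl⟩ := Fin.eq_self_or_eq_succAbove i l
    · exact hxi
    · exact Submodule.subset_span (Set.mem_range_self l)

theorem hilb_add_hilb_ker [IsScalarTower k R M] {F : Type} [AddCommGroup F] [Module k F]
    [Module R F] [IsScalarTower k R F] {πF : VecGrading k F} (φ : F →ₗ[R] M)
    (hφ : Function.Surjective φ) (hcomm : ∀ j f, π.proj j (φ f) = φ (πF.proj j f))
    (hK : ∀ j, ∀ f ∈ LinearMap.ker φ, πF.proj j f ∈ LinearMap.ker φ) (j : ℕ)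
    [FiniteDimensional k (LinearMap.range (πF.proj j))] :
    π.hilb j + (πF.restrict (LinearMap.ker φ) hK).hilb j = πF.hilb j := by
  rw [VecGrading.hilb_restrict, VecGrading.hilb, VecGrading.hilb]
  suffices hrange : LinearMap.range (π.proj j) =
      (LinearMap.range (πF.proj j)).map (φ.restrictScalars k) by
    rw [hrange]
    exact finrank_map_add_finrank_inf_ker (LinearMap.range (πF.proj j)) (φ.restrictScalars k)
  ext m
  simp only [Submodule.mem_map, π.mem_range_iff, πF.mem_range_iff]
  constructor
  · intro hm
    obtain ⟨f, rfl⟩ := hφ m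
    exact ⟨πF.proj j f, by simp [πF.proj_proj], by rw [← hm, hcomm]; rfl⟩
  · rintro ⟨f, hf, rfl⟩
    exact (hcomm j f).trans (by rw [hf]; rfl)

open CategoryTheory in
/-- The Hilbert function of a finitely generated graded module of finite projective dimension over a
noetherian connected graded algebra is eventually polynomial if that of the algebra is. -/
theorem eventuallyPoly_hilb [IsNoetherianRing R] (hρ : GradedSMulCompat ρ ρ)
    (h0 : ∀ a, ∃ c, ρ.proj 0 a = algebraMap k R c)
    (hfin : ∀ j, FiniteDimensional k (LinearMap.range (ρ.proj j)))
    (hpoly : EventuallyPoly (fun j => (ρ.hilb j : ℚ))) (b : ℕ) :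
    ∀ (M : Type) [AddCommGroup M] [Module k M] [Module R M] [IsScalarTower k R M]
      [Module.Finite R M] (π : VecGrading k M), GradedSMulCompat ρ π →
      HasProjectiveDimensionLT (ModuleCat.of R M) (b + 1) →
      EventuallyPoly (fun j => (π.hilb j : ℚ)) := by
  have hfree {r : ℕ} (e : Fin r → ℕ) : EventuallyPoly (fun j => ((ρ.free e).hilb j : ℚ)) := by
    simp only [VecGrading.hilb_free hfin e, Nat.cast_sum, Nat.cast_ite, Nat.cast_zero]
    exact EventuallyPoly.sum _ fun i _ => hpoly.shift (e i)
  induction b with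
  | zero =>
    intro M _ _ _ _ _ π hπ hpd
    have : Module.Projective R M :=
      (IsProjective.iff_projective M).2 (projective_iff_hasProjectiveDimensionLT_one.2 hpd)
    obtain ⟨r, e, φ, hφ, hcomm, hker⟩ := exists_minimal_cover hπ h0
    have hbot := ker_eq_bot_of_projective hρ e φ hφ hker
    have hK (j : ℕ) : ∀ f ∈ LinearMap.ker φ, (ρ.free e).proj j f ∈ LinearMap.ker φ := by
      simp [hbot]
    convert hfree e using 3 with j
    have := VecGrading.finiteDimensional_free hfin e j
    rw [← hilb_add_hilb_ker φ hφ hcomm hK j, VecGrading.hilb_restrict, hbot,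
      Submodule.restrictScalars_bot, inf_bot_eq, finrank_bot, add_zero]
  | succ b ih =>
    intro M _ _ _ _ _ π hπ hpd
    obtain ⟨r, e, φ, hφ, hcomm, -⟩ := exists_minimal_cover hπ h0
    have hK (j : ℕ) : ∀ f ∈ LinearMap.ker φ, (ρ.free e).proj j f ∈ LinearMap.ker φ :=
      fun f hf => by rw [LinearMap.mem_ker, ← hcomm, LinearMap.mem_ker.1 hf, map_zero]
    have hker := ih (LinearMap.ker φ) ((ρ.free e).restrict _ hK)
      (VecGrading.restrict_compat (VecGrading.free_compat hρ e) hK)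
      ((hasProjectiveDimensionLT_iff_ker φ hφ b).1 hpd)
    convert (hfree e).sub hker using 2 with j
    have := VecGrading.finiteDimensional_free hfin e j
    rw [← hilb_add_hilb_ker φ hφ hcomm hK j]
    push_cast
    ring

end Resolution

section Veronese

open MulOpposite

theorem VecGrading.proj_mem_span {k R M : Type} [Field k] [Ring R] [Algebra k R] [AddCommGroup M]
    [Module k M] [Module R M] {ρ : VecGrading k R} {π : VecGrading k M} (h : GradedSMulCompat ρ π)
    {X : Set M} (hX : ∀ x ∈ X, ∃ e, π.proj e x = x) (j : ℕ) :
    ∀ y ∈ Submodule.span R X, π.proj j y ∈ Submodule.span R X := by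
  suffices hs : ∀ y ∈ Submodule.span R X, ∀ a : R, π.proj j (a • y) ∈ Submodule.span R X by
    intro y hy
    simpa using hs y hy 1
  intro y hy
  induction hy using Submodule.span_induction with
  | mem x hx =>
    intro a
    obtain ⟨e, he⟩ := hX x hx
    rw [h.proj_smul a he]
    split_ifs
    · exact Submodule.smul_mem _ _ (Submodule.subset_span hx)
    · exact Submodule.zero_mem _
  | zero => simp
  | add x y _ _ hx hy =>
    intro a
    rw [smul_add, map_add]
    exact Submodule.add_mem _ (hx a) (hy a)
  | smul b x _ hx =>
    intro a
    rw [smul_smul]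
    exact hx _

variable {k A : Type} [Field k] [Ring A] [Algebra k A] (𝒜 : ℕ → Submodule k A) [GradedRing 𝒜]

/-- The grading of the opposite ring. -/
noncomputable def opGrading : VecGrading k Aᵐᵒᵖ :=
  (VecGrading.ofDecomposition 𝒜).congr (opLinearEquiv k)

theorem opGrading_proj (j : ℕ) (a : A) :
    (opGrading 𝒜).proj j (op a) = op ((VecGrading.ofDecomposition 𝒜).proj j a) := rfl

theorem opGrading_proj_eq_self_iff (j : ℕ) (a : A) :
    (opGrading 𝒜).proj j (op a) = op a ↔ a ∈ 𝒜 j := by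
  rw [opGrading_proj, op_inj, VecGrading.ofDecomposition_proj_eq_self_iff]

theorem opGrading_compat : GradedSMulCompat (opGrading 𝒜) (opGrading 𝒜) := by
  intro i j a x
  induction a with | _ a => ?_
  induction x with | _ x => ?_
  rw [opGrading_proj, opGrading_proj, smul_eq_mul, ← op_mul, opGrading_proj_eq_self_iff, add_comm]
  exact SetLike.mul_mem_graded (SetLike.coe_mem _) (SetLike.coe_mem _)

theorem opGrading_hilb (j : ℕ) : (opGrading 𝒜).hilb j = Module.finrank k (𝒜 j) := by
  rw [opGrading, VecGrading.hilb_congr, VecGrading.hilb,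
    VecGrading.range_ofDecomposition_proj]

theorem Algebra.adjoin_iUnion_veronese (d : ℕ) :
    Subalgebra.toSubmodule (Algebra.adjoin k (⋃ m : ℕ, (𝒜 (d * m) : Set A))) =
      Submodule.span k (⋃ m : ℕ, (𝒜 (d * m) : Set A)) := by
  apply le_antisymm
  · rw [Algebra.adjoin_eq_span]
    refine Submodule.span_mono fun a ha => ?_
    induction ha using Submonoid.closure_induction with
    | mem a ha => exact ha
    | one =>
      exact Set.mem_iUnion.2 ⟨0, by simpa using SetLike.one_mem_graded 𝒜⟩
    | mul a b _ _ ha hb =>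
      obtain ⟨i, hi⟩ := Set.mem_iUnion.1 ha
      obtain ⟨j, hj⟩ := Set.mem_iUnion.1 hb
      exact Set.mem_iUnion.2 ⟨i + j, by rw [mul_add]; exact SetLike.mul_mem_graded hi hj⟩
  · exact Submodule.span_le.2 Algebra.subset_adjoin

/-- A cyclic graded right module over the Veronese subring is the Veronese of `A / I` for a graded
right ideal `I` of `A`. -/
theorem exists_graded_rightIdeal {d : ℕ} (hd : 0 < d)
    (hfin : ∀ j, FiniteDimensional k (LinearMap.range ((opGrading 𝒜).proj j)))
    (S : Subalgebra k A) (hS : S = Algebra.adjoin k (⋃ m : ℕ, (𝒜 (d * m) : Set A)))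
    {L : Type} [AddCommGroup L] [Module k L] [Module (↥S)ᵐᵒᵖ L] [IsScalarTower k (↥S)ᵐᵒᵖ L]
    (ℒ : ℕ → Submodule k L) (hint : DirectSum.IsInternal ℒ)
    (hsmul : ∀ (i m : ℕ) (x : L) (s : ↥S), x ∈ ℒ i → (s : A) ∈ 𝒜 (d * m) →
        (op s) • x ∈ ℒ (i + m))
    (hcyc : ∃ x ∈ ℒ 0, Submodule.span (↥S)ᵐᵒᵖ {x} = ⊤) :
    ∃ I : Submodule Aᵐᵒᵖ Aᵐᵒᵖ, (∀ j, ∀ y ∈ I, (opGrading 𝒜).proj j y ∈ I) ∧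
      ∀ m, Module.finrank k (ℒ m) + Module.finrank k
        (LinearMap.range ((opGrading 𝒜).proj (d * m)) ⊓ I.restrictScalars k :
          Submodule k Aᵐᵒᵖ) = (opGrading 𝒜).hilb (d * m) := by
  classical
  obtain ⟨x, hx0, hx⟩ := hcyc
  have := hint.chooseDecomposition
  have hmem (m : ℕ) (a : A) (ha : a ∈ 𝒜 (d * m)) : a ∈ S := by
    rw [hS]
    exact Algebra.subset_adjoin (Set.mem_iUnion.2 ⟨m, ha⟩)
  have hspan : Subalgebra.toSubmodule S = Submodule.span k (⋃ m : ℕ, (𝒜 (d * m) : Set A)) := by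
    rw [hS, Algebra.adjoin_iUnion_veronese]
  let π := VecGrading.ofDecomposition 𝒜
  let T : S →ₗ[k] L :=
    { toFun s := op s • x
      map_add' s t := by rw [op_add, add_smul]
      map_smul' c s := by rw [op_smul, smul_assoc, RingHom.id_apply] }
  have hT (s : S) : T s = op s • x := rfl
  let Ψ (m : ℕ) : A →ₗ[k] L := T ∘ₗ
    (π.proj (d * m)).codRestrict (Subalgebra.toSubmodule S)
      (fun a => hmem m _ (SetLike.coe_mem (DirectSum.decompose 𝒜 a (d * m))))
  have hΨ (m : ℕ) (a : A) (s : S) (h : (s : A) = π.proj (d * m) a) : Ψ m a = op s • x := by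
    rw [← hT]
    exact congrArg T (Subtype.ext h.symm)
  have hΨmem (m : ℕ) (a : A) : Ψ m a ∈ ℒ m := by
    have := hsmul 0 m x ⟨π.proj (d * m) a, hmem m _ (SetLike.coe_mem _)⟩ hx0 (SetLike.coe_mem _)
    rwa [zero_add, ← hΨ m a _ rfl] at this
  have hproj (m : ℕ) (a : A) (ha : a ∈ Submodule.span k (⋃ m : ℕ, (𝒜 (d * m) : Set A))) :
      ∀ hs : a ∈ S, (VecGrading.ofDecomposition ℒ).proj m (T ⟨a, hs⟩) = Ψ m a := by
    induction ha using Submodule.span_induction with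
    | mem a ha =>
      intro hs
      obtain ⟨e, he⟩ := Set.mem_iUnion.1 ha
      have hTa : T ⟨a, hs⟩ ∈ ℒ e := by
        simpa [hT] using hsmul 0 e x ⟨a, hs⟩ hx0 he
      rw [VecGrading.proj_of_mem _
        ((VecGrading.ofDecomposition_proj_eq_self_iff ℒ e _).2 hTa)]
      have hpa := π.proj_of_mem ((VecGrading.ofDecomposition_proj_eq_self_iff 𝒜 _ _).2 he) (d * m)
      split_ifs with hme
      · subst hme
        exact (hΨ m a ⟨a, hs⟩ (by simpa using hpa.symm)).symm
      · rw [if_neg (fun h => hme (Nat.eq_of_mul_eq_mul_left hd h))] at hpa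
        rw [hΨ m a 0 (by simpa using hpa.symm), op_zero, zero_smul]
    | zero =>
      intro hs
      rw [map_zero, show (⟨0, hs⟩ : S) = 0 from rfl, map_zero, map_zero]
    | add a b ha hb iha ihb =>
      intro hs
      rw [← hspan] at ha hb
      rw [map_add, ← iha ha, ← ihb hb, ← map_add, ← map_add]
      rfl
    | smul c a ha iha =>
      intro hs
      rw [← hspan] at ha
      rw [map_smul, ← iha ha, ← map_smul, ← map_smul]
      rfl
  have hsurj (m : ℕ) (y : L) (hy : y ∈ ℒ m) : ∃ a ∈ 𝒜 (d * m), Ψ m a = y := by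
    obtain ⟨s, rfl⟩ := Submodule.mem_span_singleton.1 (hx ▸ Submodule.mem_top : y ∈ _)
    induction s with | _ s => ?_
    obtain ⟨a, ha⟩ := s
    refine ⟨π.proj (d * m) a, SetLike.coe_mem _, ?_⟩
    have h1 := hproj m a (by rwa [← hspan]) ha
    rw [hT, (VecGrading.ofDecomposition_proj_eq_self_iff ℒ m _).2 hy] at h1
    rw [h1, hΨ m _ ⟨π.proj (d * m) a, hmem m _ (SetLike.coe_mem _)⟩ (by simp [π.proj_proj]),
      hΨ m a ⟨π.proj (d * m) a, hmem m _ (SetLike.coe_mem _)⟩ rfl]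
  let X : Set Aᵐᵒᵖ := {y | ∃ (e : ℕ) (s : S), (s : A) ∈ 𝒜 (d * e) ∧ op s • x = 0 ∧ y = op (s : A)}
  have hX (y : Aᵐᵒᵖ) (hy : y ∈ X) : ∃ e, (opGrading 𝒜).proj e y = y := by
    obtain ⟨e, s, hs, -, rfl⟩ := hy
    exact ⟨d * e, (opGrading_proj_eq_self_iff 𝒜 _ _).2 hs⟩
  let Φ (m : ℕ) : Aᵐᵒᵖ →ₗ[k] L := Ψ m ∘ₗ (opLinearEquiv k).symm.toLinearMap
  have hΦ (m : ℕ) (a : A) : Φ m (op a) = Ψ m a := rfl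
  have hker (m : ℕ) (y : Aᵐᵒᵖ) (hy : y ∈ Submodule.span Aᵐᵒᵖ X) : ∀ a : Aᵐᵒᵖ, Φ m (a • y) = 0 := by
    induction hy using Submodule.span_induction with
    | mem y hy =>
      obtain ⟨e, s, hs, hs0, rfl⟩ := hy
      intro a
      induction a with | _ a => ?_
      have h1 := (opGrading_compat 𝒜).proj_smul (op a)
        ((opGrading_proj_eq_self_iff 𝒜 _ _).2 hs) (d * m)
      rw [smul_eq_mul, ← op_mul, opGrading_proj, opGrading_proj, smul_eq_mul, ← op_mul] at h1
      rw [smul_eq_mul, ← op_mul, hΦ]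
      split_ifs at h1 with hle
      · rw [op_inj, ← Nat.mul_sub] at h1
        rw [hΨ m _ (s * ⟨π.proj (d * (m - e)) a, hmem _ _ (SetLike.coe_mem _)⟩) h1.symm, op_mul,
          mul_smul, hs0, smul_zero]
      · rw [op_eq_zero_iff] at h1
        rw [hΨ m _ 0 h1.symm, op_zero, zero_smul]
    | zero => simp
    | add y z _ _ hy hz => intro a; rw [smul_add, map_add, hy, hz, add_zero]
    | smul b y _ hy => intro a; rw [smul_smul, hy]
  refine ⟨Submodule.span Aᵐᵒᵖ X,
    fun j => VecGrading.proj_mem_span (opGrading_compat 𝒜) hX j, fun m => ?_⟩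
  have hmap : (LinearMap.range ((opGrading 𝒜).proj (d * m))).map (Φ m) = ℒ m := by
    apply le_antisymm
    · rintro _ ⟨y, -, rfl⟩
      exact hΨmem m _
    · intro y hy
      obtain ⟨a, ha, rfl⟩ := hsurj m y hy
      exact ⟨op a, (VecGrading.mem_range_iff _).2 ((opGrading_proj_eq_self_iff 𝒜 _ _).2 ha), rfl⟩
  have hinf : LinearMap.range ((opGrading 𝒜).proj (d * m)) ⊓
      (Submodule.span Aᵐᵒᵖ X).restrictScalars k =
      LinearMap.range ((opGrading 𝒜).proj (d * m)) ⊓ LinearMap.ker (Φ m) := by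
    ext y
    simp only [Submodule.mem_inf, Submodule.restrictScalars_mem, LinearMap.mem_ker,
      and_congr_right_iff]
    intro hy
    refine ⟨fun h => by simpa using hker m y h 1, fun h => ?_⟩
    induction y with | _ a => ?_
    rw [VecGrading.mem_range_iff, opGrading_proj_eq_self_iff] at hy
    refine Submodule.subset_span ⟨m, ⟨a, hmem m a hy⟩, hy, ?_, rfl⟩
    rw [← hΨ m a ⟨a, hmem m a hy⟩
      ((VecGrading.ofDecomposition_proj_eq_self_iff 𝒜 _ _).2 hy).symm]
    exact h
  rw [hinf, ← hmap]
  exact finrank_map_add_finrank_inf_ker _ (Φ m)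

end Veronese

theorem stmt_5 (k : Type) [Field k]
    (A : Type) [Ring A] [Algebra k A]
    (𝒜 : ℕ → Submodule k A) [GradedRing 𝒜]
    -- connected graded:
    (hconn : 𝒜 0 = (1 : Submodule k A)) (hfg : Algebra.FiniteType k A)
    -- noetherian:
    (hnoethL : IsNoetherianRing A) (hnoethR : IsNoetherianRing Aᵐᵒᵖ)
    -- finite global dimension:
    (hgl : ∃ b : ℕ, GlobalDimLE A b)
    -- Hilbert series `(1-t)^{-n}` with `n ≥ 2`:
    (n : ℕ) (hn : 2 ≤ n)
    (hhilb : ∀ m : ℕ, Module.finrank k (𝒜 m) = (m + n - 1).choose (n - 1))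
    (d : ℕ) (hd : 1 < d) :
    -- the Veronese subring `A^{(d)}`:
    ∀ (S : Subalgebra k A), S = Algebra.adjoin k (⋃ m : ℕ, (𝒜 (d * m) : Set A)) →
    -- a linear right `A^{(d)}`-module `L` with Hilbert series `(1-t)^{-p}` ...
    ∀ (L : Type) (_ : AddCommGroup L), ∀ (_ : Module k L) (_ : Module (↥S)ᵐᵒᵖ L)
      (_ : IsScalarTower k (↥S)ᵐᵒᵖ L)
      (ℒ : ℕ → Submodule k L),
      DirectSum.IsInternal ℒ →
      (∀ (i m : ℕ) (x : L) (s : ↥S), x ∈ ℒ i → (s : A) ∈ 𝒜 (d * m) →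
        (MulOpposite.op s) • x ∈ ℒ (i + m)) →
      -- cyclic, generated in degree 0:
      (∃ x ∈ ℒ 0, Submodule.span (↥S)ᵐᵒᵖ {x} = ⊤) →
      ∀ p : ℕ, 1 ≤ p →
      (∀ i : ℕ, Module.finrank k (ℒ i) = (i + p - 1).choose (p - 1)) →
      -- ... is a point module:
      p = 1 := by
  intro S hS L _ _ _ _ ℒ hint hsmul hcyc p hp hL
  obtain ⟨b, -, hgl⟩ := hgl
  have hfin (j : ℕ) : FiniteDimensional k (LinearMap.range ((opGrading 𝒜).proj j)) := by
    apply Module.finite_of_finrank_pos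
    have : (opGrading 𝒜).hilb j = _ := (opGrading_hilb 𝒜 j).trans (hhilb j)
    rw [← VecGrading.hilb, this]
    exact Nat.choose_pos (by omega)
  have h0 (a : Aᵐᵒᵖ) : ∃ c, (opGrading 𝒜).proj 0 a = algebraMap k Aᵐᵒᵖ c := by
    have hmem : (VecGrading.ofDecomposition 𝒜).proj 0 a.unop ∈ 𝒜 0 := SetLike.coe_mem _
    rw [hconn, Submodule.mem_one] at hmem
    obtain ⟨c, hc⟩ := hmem
    exact ⟨c, congrArg MulOpposite.op hc.symm⟩
  have hpoly : EventuallyPoly (fun j => ((opGrading 𝒜).hilb j : ℚ)) := by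
    simp only [opGrading_hilb, hhilb]
    exact eventuallyPoly_choose n (by omega)
  obtain ⟨I, hI, hdim⟩ :=
    exists_graded_rightIdeal 𝒜 (by omega) hfin S hS ℒ hint hsmul hcyc
  have hIpoly := eventuallyPoly_hilb (opGrading_compat 𝒜) h0 hfin hpoly (b + 1) I
    ((opGrading 𝒜).restrict I hI) (VecGrading.restrict_compat (opGrading_compat 𝒜) hI)
    (exists_hasProjectiveDimensionLT b hgl _)
  refine eq_one_of_eventuallyPoly hd hp
    (fun j => (opGrading 𝒜).hilb j - ((opGrading 𝒜).restrict I hI).hilb j)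
    (by simpa using hpoly.sub hIpoly) fun m => ?_
  rw [← hL m, ← hdim m, VecGrading.hilb_restrict]
  push_cast
  ring
end
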